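/- Under the standing hypotheses, if ⟨w, x, y, z⟩ is a path in G whose three edges all lie in a single g-cycle of G, and the edge wx lies in some cycle of length g+1 in G, then the edge yz also lies in some cycle of length g+1 in G. -/

import Mathlib

open SimpleGraph

/-- Two graphs have the same `k`-deck if there is a bijection between their `k`-element
vertex subsets under which corresponding induced subgraphs are isomorphic. -/
def SameDeck {V W : Type*} [Fintype V] [Fintype W] [DecidableEq V] [DecidableEq W]
    (G : SimpleGraph V) (H : SimpleGraph W) (k : ℕ) : Prop :=
  ∃ e : {s : Finset V // s.card = k} ≃ {s : Finset W // s.card = k},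
    ∀ s : {s : Finset V // s.card = k},
      Nonempty ((G.induce (↑s.1 : Set V)) ≃g (H.induce (↑(e s).1 : Set W)))

/-- The cyclically consecutive pairs of a list. -/
def cycleEdges {V : Type*} (l : List V) : List (Sym2 V) :=
  List.zipWith (fun a b => s(a, b)) l (l.rotate 1)

section Lists
variable {V : Type*}

theorem cycleEdges_cons (a : V) (t : List V) :
    cycleEdges (a :: t) = List.zipWith (fun a b => s(a, b)) (a :: t) (t ++ [a]) := by
  simp [cycleEdges]

theorem cycleEdges_rotate (l : List V) (n : ℕ) :
    cycleEdges (l.rotate n) = (cycleEdges l).rotate n := by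
  rw [cycleEdges, cycleEdges, List.zipWith_rotate_distrib _ _ _ _ (by simp), List.rotate_rotate,
    List.rotate_rotate, add_comm]

theorem List.IsRotated.cycleEdges {l l' : List V} (h : l ~r l') :
    cycleEdges l ~r cycleEdges l' := by
  obtain ⟨n, rfl⟩ := h
  exact ⟨n, (cycleEdges_rotate l n).symm⟩

theorem cycleEdges_map {W : Type*} (f : V → W) (l : List V) :
    cycleEdges (l.map f) = (cycleEdges l).map (Sym2.map f) := by
  simp [cycleEdges, ← List.map_rotate, List.zipWith_map, List.map_zipWith]

theorem length_cycleEdges (l : List V) : (cycleEdges l).length = l.length := by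
  simp [cycleEdges]

theorem exists_of_mem_zipWith_pair {l l' : List V} {e : Sym2 V}
    (h : e ∈ List.zipWith (fun a b => s(a, b)) l l') : ∃ u ∈ l, ∃ v ∈ l', e = s(u, v) := by
  obtain ⟨i, hi, rfl⟩ := List.mem_iff_getElem.1 h
  simp only [List.length_zipWith, lt_inf_iff] at hi
  exact ⟨l[i], List.getElem_mem _, l'[i], List.getElem_mem _, by simp⟩

theorem mem_of_mem_cycleEdges {l : List V} {e : Sym2 V} (h : e ∈ cycleEdges l) {v : V}
    (hv : v ∈ e) : v ∈ l := by
  obtain ⟨a, ha, b, hb, rfl⟩ := exists_of_mem_zipWith_pair h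
  rw [List.mem_rotate] at hb
  rcases Sym2.mem_iff.1 hv with rfl | rfl <;> assumption

theorem nodup_cycleEdges {l : List V} (h : l.Nodup) (hl : 3 ≤ l.length) :
    (cycleEdges l).Nodup := by
  rw [List.nodup_iff_injective_get]
  rintro ⟨i, hi⟩ ⟨j, hj⟩ hij
  rw [length_cycleEdges] at hi hj
  simp only [cycleEdges, List.get_eq_getElem, List.getElem_zipWith, List.getElem_rotate,
    Sym2.eq_iff, h.getElem_inj_iff] at hij
  have key : ∀ k < l.length, (k + 1) % l.length = if k + 1 = l.length then 0 else k + 1 := by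
    intro k hk
    split_ifs with h0
    · simp [h0]
    · exact Nat.mod_eq_of_lt (by omega)
  rw [key i hi, key j hj] at hij
  rw [Fin.mk.injEq]
  split_ifs at hij <;> omega

theorem not_isDiag_of_mem_cycleEdges {l : List V} (h : l.Nodup) (hl : 2 ≤ l.length)
    {e : Sym2 V} (he : e ∈ cycleEdges l) : ¬ e.IsDiag := by
  obtain ⟨i, hi, rfl⟩ := List.mem_iff_getElem.1 he
  rw [length_cycleEdges] at hi
  simp only [cycleEdges, List.getElem_zipWith, List.getElem_rotate, Sym2.mk_isDiag_iff,
    h.getElem_inj_iff]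
  rcases Nat.lt_or_ge (i + 1) l.length with h1 | h1
  · rw [Nat.mod_eq_of_lt h1]; omega
  · rw [show i + 1 = l.length by omega, Nat.mod_self]; omega

theorem exists_perm_append_of_subset {s l : List V} (hs : s.Nodup) (h : s ⊆ l) :
    ∃ r, l.Perm (s ++ r) := by
  obtain ⟨s', h1, h2⟩ := List.subperm_of_subset hs h
  obtain ⟨r, hr⟩ := h2.exists_perm_append
  exact ⟨r, hr.trans (h1.append_right r)⟩

end Lists

section Switch
variable {V W : Type*}

/-- The graph obtained from `K` by replacing the edges `xa`, `yc` with `xc`, `ya`. -/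
def edgeSwitch (K : SimpleGraph V) (x y a c : V) : SimpleGraph V :=
  fromEdgeSet ((K.edgeSet \ {s(x, a), s(y, c)}) ∪ {s(x, c), s(y, a)})

theorem edgeSwitch_adj {K : SimpleGraph V} {x y a c u v : V} :
    (edgeSwitch K x y a c).Adj u v ↔
      (K.Adj u v ∧ s(u, v) ≠ s(x, a) ∧ s(u, v) ≠ s(y, c) ∨ s(u, v) = s(x, c) ∨
        s(u, v) = s(y, a)) ∧ u ≠ v := by
  simp only [edgeSwitch, fromEdgeSet_adj, Set.mem_union, Set.mem_sdiff, mem_edgeSet,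
    Set.mem_insert_iff, Set.mem_singleton_iff, not_or, ne_eq]

theorem eq_of_adj_iff_off_pair {K L : SimpleGraph V} {x y : V}
    (h : ∀ u v, u ≠ x → u ≠ y → v ≠ x → v ≠ y → (K.Adj u v ↔ L.Adj u v))
    (hx : ∀ v, K.Adj x v ↔ L.Adj x v) (hy : ∀ v, K.Adj y v ↔ L.Adj y v) : K = L := by
  ext u v
  by_cases h1 : u = x
  · rw [h1, hx]
  by_cases h2 : u = y
  · rw [h2, hy]
  by_cases h3 : v = x
  · rw [h3, adj_comm, hx, adj_comm]
  by_cases h4 : v = y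
  · rw [h4, adj_comm, hy, adj_comm]
  exact h u v h1 h2 h3 h4

open Classical in
theorem ncard_eq_ncard_diff_pair_add [Finite V] {S : Set V} {x y : V} (hxy : x ≠ y) :
    S.ncard = (S \ {x, y}).ncard + ((if x ∈ S then 1 else 0) + (if y ∈ S then 1 else 0)) := by
  have h1 : ∀ (T : Set V) (z : V), T.ncard = (T \ {z}).ncard + (if z ∈ T then 1 else 0) := by
    intro T z
    split_ifs with h
    · exact (Set.ncard_sdiff_singleton_add_one h).symm
    · rw [Set.sdiff_singleton_eq_self h, add_zero]
  rw [h1 S x, h1 (S \ {x}) y, Set.sdiff_sdiff, Set.singleton_union]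
  have : y ∈ S \ {x} ↔ y ∈ S := by simp [hxy.symm]
  simp only [this]
  omega

open Classical in
theorem sum_ite_eq_ncard [Finite V] {S : Set V} {F : Finset V} (h : S ⊆ F) :
    S.ncard = ∑ v ∈ F, if v ∈ S then 1 else 0 := by
  rw [← Finset.card_filter, ← Set.ncard_coe_finset]
  congr 1
  ext v
  simp only [Finset.coe_filter, Set.mem_ofPred_eq]
  exact ⟨fun hv => ⟨h hv, hv⟩, fun hv => hv.2⟩

/-- A cubic graph that agrees with `K` away from the ends of the edge `xy` is, up to exchanging
`x` and `y`, either `K` or one of the two switches of `K` along `xy`. -/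
theorem eq_or_eq_edgeSwitch [Finite V] {K L : SimpleGraph V}
    (hK : ∀ v, (K.neighborSet v).ncard = 3) (hL : ∀ v, (L.neighborSet v).ncard = 3)
    {x y a b c d : V} (hnd : [x, y, a, b, c, d].Nodup)
    (hx : ∀ v, K.Adj x v ↔ v = y ∨ v = a ∨ v = b) (hy : ∀ v, K.Adj y v ↔ v = x ∨ v = c ∨ v = d)
    (hoff : ∀ u v, u ≠ x → u ≠ y → v ≠ x → v ≠ y → (K.Adj u v ↔ L.Adj u v))
    (hb : L.Adj x b ∨ ¬ L.Adj y b) : L = K ∨ L = edgeSwitch K x y a c ∨ L = edgeSwitch K x y a d := by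
  classical
  simp only [List.nodup_cons, List.mem_cons, List.not_mem_nil, not_or, or_false, not_false_eq_true,
    List.nodup_nil, and_true] at hnd
  obtain ⟨⟨hxy, hxa, hxb, hxc, hxd⟩, ⟨hya, hyb, hyc, hyd⟩, ⟨hab, hac, had⟩, ⟨hbc, hbd⟩, hcd⟩ := hnd
  have hcount : ∀ v, v ≠ x → v ≠ y →
      (if K.Adj x v then 1 else 0) + (if K.Adj y v then 1 else 0) =
        (if L.Adj x v then 1 else 0) + (if L.Adj y v then 1 else 0) := by
    intro v h1 h2
    have e1 := hK v
    have e2 := hL v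
    rw [ncard_eq_ncard_diff_pair_add hxy] at e1 e2
    have : K.neighborSet v \ {x, y} = L.neighborSet v \ {x, y} := by
      ext u
      simp only [Set.mem_sdiff, mem_neighborSet, Set.mem_insert_iff, Set.mem_singleton_iff, not_or]
      refine and_congr_left fun hu => hoff v u h1 h2 hu.1 hu.2
    rw [this] at e1
    simp only [mem_neighborSet, K.adj_comm v, L.adj_comm v] at e1 e2
    omega
  have ca := hcount a (Ne.symm hxa) (Ne.symm hya)
  have cb := hcount b (Ne.symm hxb) (Ne.symm hyb)
  have cc := hcount c (Ne.symm hxc) (Ne.symm hyc)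
  have cd := hcount d (Ne.symm hxd) (Ne.symm hyd)
  have hout : ∀ v, v ≠ x → v ≠ y → v ≠ a → v ≠ b → v ≠ c → v ≠ d → ¬ L.Adj x v ∧ ¬ L.Adj y v := by
    intro v h1 h2 h3 h4 h5 h6
    have := hcount v h1 h2
    rw [hx, hy, if_neg (by simp [*]), if_neg (by simp [*])] at this
    constructor <;> intro h <;> rw [if_pos h] at this <;> omega
  have sx : (L.neighborSet x) ⊆ (({y, a, b, c, d} : Finset V) : Set V) := by
    intro v hv
    by_contra h
    simp only [Finset.coe_insert, Finset.coe_singleton, Set.mem_insert_iff, Set.mem_singleton_iff,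
      not_or] at h
    exact (hout v (L.ne_of_adj hv).symm h.1 h.2.1 h.2.2.1 h.2.2.2.1 h.2.2.2.2).1 hv
  have sy : (L.neighborSet y) ⊆ (({x, a, b, c, d} : Finset V) : Set V) := by
    intro v hv
    by_contra h
    simp only [Finset.coe_insert, Finset.coe_singleton, Set.mem_insert_iff, Set.mem_singleton_iff,
      not_or] at h
    exact (hout v h.1 (L.ne_of_adj hv).symm h.2.1 h.2.2.1 h.2.2.2.1 h.2.2.2.2).2 hv
  have nx := hL x
  have ny := hL y
  rw [sum_ite_eq_ncard sx] at nx
  rw [sum_ite_eq_ncard sy] at ny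
  simp only [mem_neighborSet] at nx ny
  rw [Finset.sum_insert (by simp [*]), Finset.sum_insert (by simp [*]),
    Finset.sum_insert (by simp [*]), Finset.sum_insert (by simp [*]), Finset.sum_singleton] at nx ny
  rw [L.adj_comm y x] at ny
  simp only [hx, hy, hab, hac, had, hbc, hbd, hcd, Ne.symm hab, Ne.symm hac, Ne.symm had,
    Ne.symm hbc, Ne.symm hbd, Ne.symm hcd, Ne.symm hxa, Ne.symm hxb, Ne.symm hxc, Ne.symm hxd,
    Ne.symm hya, Ne.symm hyb, Ne.symm hyc, Ne.symm hyd, if_true, if_false, or_true, or_false] at ca cb cc cd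
  have hxL : L.Adj x y := by
    by_contra h
    rw [if_neg h] at nx ny
    omega
  rw [if_pos hxL] at nx ny
  replace hb : ¬ L.Adj y b := by
    rcases hb with hb | hb
    · intro h
      rw [if_pos hb, if_pos h] at cb
      omega
    · exact hb
  rw [if_neg hb] at ny cb
  have key : ∀ T : SimpleGraph V,
      (∀ u v, u ≠ x → u ≠ y → v ≠ x → v ≠ y → (K.Adj u v ↔ T.Adj u v)) →
      (∀ v, L.Adj x v ↔ T.Adj x v) → (∀ v, L.Adj y v ↔ T.Adj y v) → L = T := by
    intro T h1 h2 h3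
    exact eq_of_adj_iff_off_pair (fun u v a1 a2 a3 a4 => (hoff u v a1 a2 a3 a4).symm.trans
      (h1 u v a1 a2 a3 a4)) h2 h3
  have hb' : L.Adj x b := by
    by_contra h
    rw [if_neg h] at cb
    omega
  rw [if_pos hb'] at nx
  have hxx : ¬ L.Adj x x := L.loopless.irrefl x
  have hyy : ¬ L.Adj y y := L.loopless.irrefl y
  have hyxL := hxL.symm
  by_cases h1 : L.Adj x a
  · left
    rw [if_pos h1] at nx ca
    have h2 : ¬ L.Adj y a := by intro h; rw [if_pos h] at ca; omega
    have h3 : ¬ L.Adj x c := by intro h; rw [if_pos h] at nx; omega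
    have h4 : ¬ L.Adj x d := by intro h; rw [if_pos h] at nx; omega
    have h5 : L.Adj y c := by by_contra h; rw [if_neg h, if_neg h3] at cc; omega
    have h6 : L.Adj y d := by by_contra h; rw [if_neg h, if_neg h4] at cd; omega
    refine key K (fun _ _ _ _ _ _ => Iff.rfl) ?_ ?_ <;> intro v
    · rw [hx]; grind
    · rw [hy]; grind
  · right
    rw [if_neg h1] at nx ca
    have h2 : L.Adj y a := by by_contra h; rw [if_neg h] at ca; omega
    by_cases h3 : L.Adj x c
    · left
      rw [if_pos h3] at nx cc
      have h4 : ¬ L.Adj x d := by intro h; rw [if_pos h] at nx; omega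
      have h5 : ¬ L.Adj y c := by intro h; rw [if_pos h] at cc; omega
      have h6 : L.Adj y d := by by_contra h; rw [if_neg h, if_neg h4] at cd; omega
      refine key _ ?_ ?_ ?_
      · intro u v _ _ _ _
        rw [edgeSwitch_adj]
        simp only [ne_eq, Sym2.eq_iff]
        have : K.Adj u v → u ≠ v := K.ne_of_adj
        grind
      · intro v
        rw [edgeSwitch_adj, hx]
        simp only [ne_eq, Sym2.eq_iff]
        grind
      · intro v
        rw [edgeSwitch_adj, hy]
        simp only [ne_eq, Sym2.eq_iff]
        grind
    · right
      rw [if_neg h3] at nx cc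
      have h4 : L.Adj x d := by by_contra h; rw [if_neg h] at nx; omega
      have h5 : L.Adj y c := by by_contra h; rw [if_neg h] at cc; omega
      have h6 : ¬ L.Adj y d := by intro h; rw [if_pos h, if_pos h4] at cd; omega
      refine key _ ?_ ?_ ?_
      · intro u v _ _ _ _
        rw [edgeSwitch_adj]
        simp only [ne_eq, Sym2.eq_iff]
        have : K.Adj u v → u ≠ v := K.ne_of_adj
        grind
      · intro v
        rw [edgeSwitch_adj, hx]
        simp only [ne_eq, Sym2.eq_iff]
        grind
      · intro v
        rw [edgeSwitch_adj, hy]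
        simp only [ne_eq, Sym2.eq_iff]
        grind

theorem ncard_neighborSet_of_iso {K : SimpleGraph V} {L : SimpleGraph W} (φ : K ≃g L) (v : V) :
    (L.neighborSet (φ v)).ncard = (K.neighborSet v).ncard :=
  (Nat.card_congr (φ.mapNeighborSet v)).symm

/-- An isomorphism between subgraphs missing two vertices extends to a bijection of vertices. -/
theorem exists_equiv_of_induce_iso [Fintype V] [Fintype W] [DecidableEq V] [DecidableEq W]
    {K : SimpleGraph V} {L : SimpleGraph W} (hcard : Fintype.card V = Fintype.card W)
    {s : Finset V} {t : Finset W} {x y : V} (hxy : x ≠ y) (hs : ∀ v, v ∈ s ↔ v ≠ x ∧ v ≠ y)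
    (ht : t.card = Fintype.card V - 2)
    (φ : K.induce (s : Set V) ≃g L.induce (t : Set W)) :
    ∃ F : V ≃ W, ∀ u v, u ≠ x → u ≠ y → v ≠ x → v ≠ y → (K.Adj u v ↔ L.Adj (F u) (F v)) := by
  have h2 : 2 ≤ Fintype.card V := by
    rw [← Finset.card_pair hxy]
    exact Finset.card_le_univ _
  have : tᶜ.card = 2 := by
    rw [Finset.card_compl, ht, ← hcard]
    omega
  obtain ⟨x', y', hxy', ht'⟩ := Finset.card_eq_two.1 this
  have hx' : x' ∉ t := by
    rw [← Finset.mem_compl, ht']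
    simp
  have hy' : y' ∉ t := by
    rw [← Finset.mem_compl, ht']
    simp
  let f : V → W := fun v => if h : v ∈ s then (φ ⟨v, h⟩ : W) else if v = x then x' else y'
  have hf : ∀ v (h : v ∈ s), f v = φ ⟨v, h⟩ := fun v h => dif_pos h
  have hft : ∀ v ∈ s, f v ∈ t := fun v h => by
    rw [hf v h]
    exact (φ ⟨v, h⟩).2
  have hfx : f x = x' := by simp [f, hs]
  have hfy : f y = y' := by simp [f, hs, hxy.symm]
  have hcov : ∀ v, v ∈ s ∨ v = x ∨ v = y := fun v => by
    rw [hs]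
    tauto
  have hinj : Function.Injective f := by
    intro u v huv
    rcases hcov u with hu | rfl | rfl <;> rcases hcov v with hv | rfl | rfl
    · rw [hf u hu, hf v hv] at huv
      simpa using φ.injective (Subtype.ext huv)
    · exact absurd (hft u hu) (by rwa [huv, hfx])
    · exact absurd (hft u hu) (by rwa [huv, hfy])
    · exact absurd (hft v hv) (by rwa [← huv, hfx])
    · rfl
    · exact absurd huv (by rwa [hfx, hfy])
    · exact absurd (hft v hv) (by rwa [← huv, hfy])
    · exact absurd huv.symm (by rwa [hfx, hfy])
    · rfl
  refine ⟨Equiv.ofBijective f ((Fintype.bijective_iff_injective_and_card f).2 ⟨hinj, hcard⟩), ?_⟩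
  intro u v h1 h2 h3 h4
  have hu := (hs u).2 ⟨h1, h2⟩
  have hv := (hs v).2 ⟨h3, h4⟩
  rw [Equiv.ofBijective_apply, Equiv.ofBijective_apply, hf u hu, hf v hv]
  exact (φ.map_rel_iff (a := ⟨u, hu⟩) (b := ⟨v, hv⟩)).symm

theorem exists_iso_edgeSwitch [Fintype V] [Fintype W] [DecidableEq V] [DecidableEq W]
    {K : SimpleGraph V} {L : SimpleGraph W}
    (hK : ∀ v, (K.neighborSet v).ncard = 3) (hL : ∀ v, (L.neighborSet v).ncard = 3)
    (hcard : Fintype.card V = Fintype.card W)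
    (hdeck : ∀ s : Finset V, s.card = Fintype.card V - 2 → ∃ t : Finset W,
      t.card = Fintype.card V - 2 ∧ Nonempty (K.induce (s : Set V) ≃g L.induce (t : Set W)))
    (hn : ¬ Nonempty (K ≃g L)) {x y a b c d : V} (hnd : [x, y, a, b, c, d].Nodup)
    (hx : ∀ v, K.Adj x v ↔ v = y ∨ v = a ∨ v = b)
    (hy : ∀ v, K.Adj y v ↔ v = x ∨ v = c ∨ v = d) :
    Nonempty (edgeSwitch K x y a c ≃g L) ∨ Nonempty (edgeSwitch K x y a d ≃g L) := by
  have hxy : x ≠ y := by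
    rintro rfl
    simp at hnd
  obtain ⟨t, ht, ⟨φ⟩⟩ := hdeck ({x, y}ᶜ) (by rw [Finset.card_compl, Finset.card_pair hxy])
  obtain ⟨F, hF⟩ := exists_equiv_of_induce_iso hcard hxy (by simp) ht φ
  have main : ∀ F : V ≃ W, (∀ u v, u ≠ x → u ≠ y → v ≠ x → v ≠ y →
      (K.Adj u v ↔ L.Adj (F u) (F v))) → L.Adj (F x) (F b) ∨ ¬ L.Adj (F y) (F b) →
      Nonempty (edgeSwitch K x y a c ≃g L) ∨ Nonempty (edgeSwitch K x y a d ≃g L) := by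
    intro F hF hb
    have hiso : L.comap F ≃g L := Iso.comap F L
    rcases eq_or_eq_edgeSwitch hK (L := L.comap F)
      (fun v => by rw [← hL (Iso.comap F L v), ncard_neighborSet_of_iso]) hnd hx hy hF hb
      with h | h | h
    · exact absurd ⟨h ▸ hiso⟩ hn
    · exact Or.inl ⟨h ▸ hiso⟩
    · exact Or.inr ⟨h ▸ hiso⟩
  by_cases hb : L.Adj (F x) (F b)
  · exact main F hF (Or.inl hb)
  · have hbxy : b ≠ x ∧ b ≠ y := by
      simp only [List.nodup_cons, List.mem_cons, List.not_mem_nil, not_or] at hnd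
      tauto
    refine main ((Equiv.swap x y).trans F) ?_ (Or.inr ?_)
    · intro u v h1 h2 h3 h4
      simp only [Equiv.trans_apply, Equiv.swap_apply_of_ne_of_ne h1 h2,
        Equiv.swap_apply_of_ne_of_ne h3 h4]
      exact hF u v h1 h2 h3 h4
    · simpa [Equiv.swap_apply_of_ne_of_ne hbxy.1 hbxy.2] using hb

end Switch

section Setup
variable {V W : Type*}

/-- Every cycle of `K`, given as a list of vertices, has length at least `g`. -/
def CyclesGe (g : ℕ) (K : SimpleGraph V) : Prop :=
  ∀ l : List V, l.Nodup → 3 ≤ l.length → (∀ e ∈ cycleEdges l, e ∈ K.edgeSet) → g ≤ l.length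

theorem cycleEdges_map_subset {K : SimpleGraph V} {L : SimpleGraph W} (f : V → W)
    (hf : ∀ u v, K.Adj u v → L.Adj (f u) (f v)) {l : List V}
    (h : ∀ e ∈ cycleEdges l, e ∈ K.edgeSet) : ∀ e ∈ cycleEdges (l.map f), e ∈ L.edgeSet := by
  rw [cycleEdges_map]
  intro e he
  obtain ⟨e', he', rfl⟩ := List.mem_map.1 he
  have := h e' he'
  induction e' with
  | _ u v => exact hf u v this

theorem CyclesGe.of_iso {g : ℕ} {K : SimpleGraph V} {L : SimpleGraph W} (h : CyclesGe g L)
    (φ : K ≃g L) : CyclesGe g K := by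
  intro l h1 h2 h3
  simpa using h (l.map φ) (h1.map φ.injective) (by simpa)
    (cycleEdges_map_subset φ (fun _ _ => φ.map_rel_iff.2) h3)

theorem exists_walk_of_list {K : SimpleGraph V} (t : List V) (a b : V)
    (h : ∀ e ∈ List.zipWith (fun a b => s(a, b)) (a :: t) (t ++ [b]), e ∈ K.edgeSet) :
    ∃ p : K.Walk a b, p.support = a :: t ++ [b] ∧
      p.edges = List.zipWith (fun a b => s(a, b)) (a :: t) (t ++ [b]) := by
  induction t generalizing a with
  | nil =>
    have hab : K.Adj a b := by simpa using h
    exact ⟨hab.toWalk, by simp, by simp⟩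
  | cons c t ih =>
    simp only [List.cons_append, List.zipWith_cons_cons, List.mem_cons, forall_eq_or_imp] at h
    obtain ⟨p, hp, hp'⟩ := ih c (by simpa using h.2)
    have hac : K.Adj a c := h.1
    exact ⟨.cons hac p, by rw [Walk.support_cons, hp]; rfl, by rw [Walk.edges_cons, hp']; rfl⟩

theorem exists_isCycle_of_cycleEdges {K : SimpleGraph V} {l : List V} (hl : l.Nodup)
    (h3 : 3 ≤ l.length) (h : ∀ e ∈ cycleEdges l, e ∈ K.edgeSet) :
    ∃ (v : V) (p : K.Walk v v), p.IsCycle ∧ p.length = l.length := by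
  rcases l with _ | ⟨a, t⟩
  · simp at h3
  rw [cycleEdges_cons] at h
  obtain ⟨p, hp, hp'⟩ := exists_walk_of_list t a a h
  refine ⟨a, p, ?_, by rw [← p.length_edges, hp']; simp⟩
  rw [Walk.isCycle_def, Walk.isTrail_def, hp', ← cycleEdges_cons, hp]
  refine ⟨nodup_cycleEdges hl h3, ?_, ?_⟩
  · rintro rfl
    simp at hp
  · simpa [List.nodup_append, and_comm, ← List.forall_mem_ne'] using hl

theorem exists_list_of_isCycle {K : SimpleGraph V} {v : V} {p : K.Walk v v} (hp : p.IsCycle) :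
    ∃ l : List V, l.Nodup ∧ l.length = p.length ∧ cycleEdges l = p.edges := by
  refine ⟨p.support.dropLast, hp.nodup_dropLast_support, by simp, ?_⟩
  have h1 : p.support = p.support.dropLast ++ [v] := by
    conv_lhs => rw [← List.dropLast_append_getLast p.support_ne_nil, p.getLast_support]
  rcases p with _ | ⟨h, q⟩
  · exact absurd rfl hp.ne_nil
  rw [Walk.edges_eq_zipWith_support]
  have h2 : (Walk.cons h q).support.dropLast = v :: q.support.dropLast := by
    rw [Walk.support_cons, List.dropLast_cons_of_ne_nil q.support_ne_nil]
  rw [h2] at h1 ⊢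
  rw [h1, cycleEdges_cons]
  generalize q.support.dropLast = t
  have := List.zipWith_append (f := fun a b : V => s(a, b)) (l₁ := v :: t) (l₂ := t ++ [v])
    (l₁' := [v]) (l₂' := []) (by simp)
  simpa using this.symm

theorem cyclesGe_of_egirth {g : ℕ} {K : SimpleGraph V} (h : K.egirth = g) : CyclesGe g K := by
  intro l h1 h2 h3
  obtain ⟨v, p, hp, hpl⟩ := exists_isCycle_of_cycleEdges h1 h2 h3
  rw [← hpl]
  have := egirth_le_length hp
  rw [h] at this
  exact_mod_cast this

/-- Every `k`-vertex induced subgraph of `K` is an induced subgraph of `L`. -/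
def DeckSubset (K : SimpleGraph V) (L : SimpleGraph W) (k : ℕ) : Prop :=
  ∀ s : Finset V, s.card = k → ∃ t : Finset W,
      t.card = k ∧ Nonempty (K.induce (s : Set V) ≃g L.induce (t : Set W))

theorem DeckSubset.of_iso {U : Type*} {K : SimpleGraph U} {G : SimpleGraph V} {L : SimpleGraph W}
    {k : ℕ} (h : DeckSubset G L k) (φ : K ≃g G) : DeckSubset K L k := by
  intro s hs
  obtain ⟨t, ht, ⟨ψ⟩⟩ := h (s.map φ.toEquiv.toEmbedding) (by simpa)
  refine ⟨t, ht, ⟨(φ.induce ?_).trans ψ⟩⟩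
  rw [Finset.coe_map]
  exact φ.injective.injOn.bijOn_image

theorem SameDeck.deckSubset [Fintype V] [Fintype W] [DecidableEq V] [DecidableEq W]
    {G : SimpleGraph V} {H : SimpleGraph W} {k : ℕ} (h : SameDeck G H k) :
    DeckSubset G H k ∧ DeckSubset H G k := by
  obtain ⟨e, he⟩ := h
  refine ⟨fun s hs => ⟨(e ⟨s, hs⟩).1, (e ⟨s, hs⟩).2, he ⟨s, hs⟩⟩, fun t ht => ?_⟩
  obtain ⟨φ⟩ := he (e.symm ⟨t, ht⟩)
  rw [Equiv.apply_symm_apply] at φ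
  exact ⟨_, (e.symm ⟨t, ht⟩).2, ⟨φ.symm⟩⟩

theorem DeckSubset.cyclesGe [Fintype W] {G : SimpleGraph V} {H : SimpleGraph W} {k g : ℕ}
    (h : DeckSubset H G k) (hk : k ≤ Fintype.card W) (hg : g ≤ k + 1) (hG : CyclesGe g G) :
    CyclesGe g H := by
  classical
  intro l h1 h2 h3
  by_contra! hlt
  obtain ⟨s, hls, -, hs⟩ := Finset.exists_subsuperset_card_eq (s := l.toFinset)
    (Finset.subset_univ _) (n := k) ((List.toFinset_card_le l).trans (by omega))
    (by rwa [Finset.card_univ])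
  obtain ⟨t, -, ⟨φ⟩⟩ := h s hs
  have hmem : ∀ v ∈ l, v ∈ (s : Set W) := fun v hv => hls (by simpa)
  lift l to List (s : Set W) using hmem
  have hφ := hG ((l.map φ).map Subtype.val)
    (((h1.of_map _).map φ.injective).map Subtype.val_injective) (by simpa using h2)
    (cycleEdges_map_subset Subtype.val (K := G.induce (t : Set V)) (fun _ _ h => h)
      (cycleEdges_map_subset (K := H.induce (s : Set W)) φ (fun _ _ => φ.map_rel_iff.2) ?_))
  · simp only [List.length_map] at hφ hlt
    omega
  · intro e he
    rw [cycleEdges_map] at h3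
    have := h3 _ (List.mem_map_of_mem he)
    induction e with
    | _ u v => exact this

/-- Two isomorphism classes of cubic graphs of girth at least `g`, exchanged by edge switches. -/
structure SwitchClosed (g : ℕ) (P : Bool → SimpleGraph V → Prop) : Prop where
  cubic : ∀ {b K}, P b K → ∀ v, (K.neighborSet v).ncard = 3
  cyclesGe : ∀ {b K}, P b K → CyclesGe g K
  not_both : ∀ {b K}, P b K → ¬ P (!b) K
  iso : ∀ {b K L}, P b K → P b L → Nonempty (K ≃g L)
  switch : ∀ {b K x y a a' c d}, P b K → [x, y, a, a', c, d].Nodup →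
    (∀ v, K.Adj x v ↔ v = y ∨ v = a ∨ v = a') → (∀ v, K.Adj y v ↔ v = x ∨ v = c ∨ v = d) →
    P (!b) (edgeSwitch K x y a c) ∨ P (!b) (edgeSwitch K x y a d)

theorem switchClosed_of_sameDeck [Fintype V] [Fintype W] [DecidableEq V] [DecidableEq W]
    {G : SimpleGraph V} {H : SimpleGraph W} [DecidableRel G.Adj] [DecidableRel H.Adj]
    (hG : G.IsRegularOfDegree 3) (hH : H.IsRegularOfDegree 3)
    (hcard : Fintype.card V = Fintype.card W)
    (hdeck : SameDeck G H (Fintype.card V - 2))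
    (hniso : ¬ Nonempty (G ≃g H))
    {g : ℕ} (hgirth : CyclesGe g G) (hgn : g + 1 ≤ Fintype.card V) :
    SwitchClosed g (fun (b : Bool) (K : SimpleGraph V) =>
      if b then Nonempty (K ≃g G) else Nonempty (K ≃g H)) := by
  have hGc : ∀ v, (G.neighborSet v).ncard = 3 := fun v => by
    rw [← hG v, ← card_neighborSet_eq_degree, Set.ncard_eq_toFinset_card', Set.toFinset_card]
  have hHc : ∀ v, (H.neighborSet v).ncard = 3 := fun v => by
    rw [← hH v, ← card_neighborSet_eq_degree, Set.ncard_eq_toFinset_card', Set.toFinset_card]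
  have hHg : CyclesGe g H := hdeck.deckSubset.2.cyclesGe (by omega) (by omega) hgirth
  refine ⟨?_, ?_, ?_, ?_, ?_⟩
  · rintro (_ | _) K hK v
    · obtain ⟨φ⟩ : Nonempty (K ≃g H) := by simpa using hK
      rw [← ncard_neighborSet_of_iso φ, hHc]
    · obtain ⟨φ⟩ : Nonempty (K ≃g G) := by simpa using hK
      rw [← ncard_neighborSet_of_iso φ, hGc]
  · rintro (_ | _) K hK
    · obtain ⟨φ⟩ : Nonempty (K ≃g H) := by simpa using hK
      exact hHg.of_iso φ
    · obtain ⟨φ⟩ : Nonempty (K ≃g G) := by simpa using hK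
      exact hgirth.of_iso φ
  · rintro (_ | _) K h1 h2
    · obtain ⟨φ⟩ : Nonempty (K ≃g H) := by simpa using h1
      obtain ⟨ψ⟩ : Nonempty (K ≃g G) := by simpa using h2
      exact hniso ⟨ψ.symm.trans φ⟩
    · obtain ⟨φ⟩ : Nonempty (K ≃g G) := by simpa using h1
      obtain ⟨ψ⟩ : Nonempty (K ≃g H) := by simpa using h2
      exact hniso ⟨φ.symm.trans ψ⟩
  · rintro (_ | _) K L h1 h2
    · obtain ⟨φ⟩ : Nonempty (K ≃g H) := by simpa using h1
      obtain ⟨ψ⟩ : Nonempty (L ≃g H) := by simpa using h2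
      exact ⟨φ.trans ψ.symm⟩
    · obtain ⟨φ⟩ : Nonempty (K ≃g G) := by simpa using h1
      obtain ⟨ψ⟩ : Nonempty (L ≃g G) := by simpa using h2
      exact ⟨φ.trans ψ.symm⟩
  · rintro (_ | _) K x y a a' c d hK hnd hx hy
    · obtain ⟨φ⟩ : Nonempty (K ≃g H) := by simpa using hK
      have := exists_iso_edgeSwitch (L := G)
        (fun v => by rw [← ncard_neighborSet_of_iso φ, hHc]) hGc rfl
        (hdeck.deckSubset.2.of_iso φ) (fun ⟨ψ⟩ => hniso ⟨ψ.symm.trans φ⟩) hnd hx hy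
      simpa using this
    · obtain ⟨φ⟩ : Nonempty (K ≃g G) := by simpa using hK
      have := exists_iso_edgeSwitch (L := H)
        (fun v => by rw [← ncard_neighborSet_of_iso φ, hGc]) hHc hcard
        (hdeck.deckSubset.1.of_iso φ) (fun ⟨ψ⟩ => hniso ⟨φ.symm.trans ψ⟩) hnd hx hy
      simpa using this

end Setup

section Config
variable {V : Type*} {g : ℕ} {P : Bool → SimpleGraph V → Prop} {K B : SimpleGraph V} {b : Bool}
  {l l' : List V}

theorem exists_third_neighbor {x y a : V} (hK : (K.neighborSet x).ncard = 3) (hy : K.Adj x y)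
    (ha : K.Adj x a) (hya : a ≠ y) :
    ∃ a', a' ≠ y ∧ a' ≠ a ∧ ∀ v, K.Adj x v ↔ v = y ∨ v = a ∨ v = a' := by
  obtain ⟨p, q, r, hpq, hpr, hqr, h⟩ := Set.ncard_eq_three.1 hK
  have key : ∀ v, K.Adj x v ↔ v = p ∨ v = q ∨ v = r := by
    intro v
    rw [← mem_neighborSet, h]
    simp
  have h1 := (key y).1 hy
  have h2 := (key a).1 ha
  have : ∃ a', a' ≠ y ∧ a' ≠ a ∧ ∀ v, (v = p ∨ v = q ∨ v = r) ↔ v = y ∨ v = a ∨ v = a' := by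
    rcases h1 with rfl | rfl | rfl <;> rcases h2 with rfl | rfl | rfl <;>
      first | exact absurd rfl hya | skip
    · exact ⟨r, by grind⟩
    · exact ⟨q, by grind⟩
    · exact ⟨r, by grind⟩
    · exact ⟨p, by grind⟩
    · exact ⟨q, by grind⟩
    · exact ⟨p, by grind⟩
  simpa only [key] using this

theorem CyclesGe.not_triangle (h : CyclesGe g K) (hg : 4 ≤ g) {u v w : V} (h1 : K.Adj u v)
    (h2 : K.Adj v w) (h3 : K.Adj u w) : False := by
  have := h [u, v, w] (by simp [h1.ne, h2.ne, h3.ne]) (by simp)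
    (by simp [cycleEdges, h1, h2, h3.symm])
  simp at this
  omega

/-- The graph `B` together with the cycle through the vertices of `l`. -/
def withCycle (B : SimpleGraph V) (l : List V) : SimpleGraph V :=
  B ⊔ fromEdgeSet {e | e ∈ cycleEdges l}

theorem edgeSet_withCycle (hl : l.Nodup) (h2 : 2 ≤ l.length) :
    (withCycle B l).edgeSet = B.edgeSet ∪ {e | e ∈ cycleEdges l} := by
  rw [withCycle, edgeSet_sup, edgeSet_fromEdgeSet]
  congr 1
  ext e
  simp only [Set.mem_sdiff, Set.mem_ofPred_eq, and_iff_left_iff_imp]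
  exact not_isDiag_of_mem_cycleEdges hl h2

theorem withCycle_congr (h : ∀ e, e ∈ cycleEdges l ↔ e ∈ cycleEdges l') :
    withCycle B l = withCycle B l' := by
  simp only [withCycle, h]

/-- The cycle `l` is edge-disjoint from `B`, has length `g`, and `B` with `l` is in class `b`. -/
structure Config (P : Bool → SimpleGraph V → Prop) (g : ℕ) (b : Bool) (B : SimpleGraph V)
    (l : List V) : Prop where
  nodup : l.Nodup
  length_eq : l.length = g
  mem : P b (withCycle B l)
  disj : ∀ e ∈ cycleEdges l, e ∉ B.edgeSet

theorem Config.of_isRotated (hc : Config P g b B l) (h : l ~r l') : Config P g b B l' := by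
  refine ⟨h.nodup_iff.1 hc.nodup, by rw [← h.perm.length_eq, hc.length_eq], ?_, ?_⟩
  · rw [← withCycle_congr fun e => h.cycleEdges.mem_iff]
    exact hc.mem
  · simpa only [← h.cycleEdges.mem_iff] using hc.disj

theorem Config.swap (h : SwitchClosed g P) (hg : 4 ≤ g) {a x y d : V} {ρ : List V}
    (hc : Config P g b B (a :: x :: y :: d :: ρ)) : Config P g (!b) B (a :: y :: x :: d :: ρ) := by
  obtain ⟨hnd, hlen, hmem, hdisj⟩ := hc
  have hnd' : (a :: y :: x :: d :: ρ).Nodup :=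
    (List.Perm.cons a (List.Perm.swap y x (d :: ρ))).nodup_iff.1 hnd
  have hE : ∀ e, e ∈ (withCycle B (a :: x :: y :: d :: ρ)).edgeSet ↔
      e ∈ B.edgeSet ∨ e ∈ cycleEdges (a :: x :: y :: d :: ρ) := by
    intro e
    rw [edgeSet_withCycle hnd (by simp)]
    rfl
  have hE' : ∀ e, e ∈ (withCycle B (a :: y :: x :: d :: ρ)).edgeSet ↔
      e ∈ B.edgeSet ∨ e ∈ cycleEdges (a :: y :: x :: d :: ρ) := by
    intro e
    rw [edgeSet_withCycle hnd' (by simp)]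
    rfl
  have htail : ∀ e ∈ List.zipWith (fun a b : V => s(a, b)) (d :: ρ) (ρ ++ [a]),
      x ∉ e ∧ y ∉ e := by
    intro e he
    obtain ⟨u, hu, v, hv, rfl⟩ := exists_of_mem_zipWith_pair he
    simp only [List.nodup_cons, List.mem_cons, not_or] at hnd hu
    simp only [List.mem_append, List.mem_singleton] at hv
    simp only [Sym2.mem_iff]
    grind
  simp only [cycleEdges_cons, List.cons_append, List.zipWith_cons_cons, List.mem_cons] at hE hE' hdisj
  set K := withCycle B (a :: x :: y :: d :: ρ) with hK
  have hcub := h.cubic hmem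
  have htri : ∀ u v w, K.Adj u v → K.Adj v w → K.Adj u w → False :=
    fun u v w => (h.cyclesGe hmem).not_triangle hg
  have hax : K.Adj a x := (hE s(a, x)).2 (by simp)
  have hxy : K.Adj x y := (hE s(x, y)).2 (by simp)
  have hyd : K.Adj y d := (hE s(y, d)).2 (by simp)
  have hay : a ≠ y := by rintro rfl; simp at hnd
  have hdx : d ≠ x := by rintro rfl; simp at hnd
  have had : a ≠ d := by rintro rfl; simp at hnd
  obtain ⟨x', hx1, hx2, hNx⟩ := exists_third_neighbor (hcub x) hxy hax.symm hay
  obtain ⟨y', hy1, hy2, hNy⟩ := exists_third_neighbor (hcub y) hxy.symm hyd hdx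
  have hxx' : K.Adj x x' := (hNx _).2 (by simp)
  have hyy' : K.Adj y y' := (hNy _).2 (by simp)
  have e1 : x' ≠ d := by rintro rfl; exact htri _ _ _ hxy hyd hxx'
  have e2 : a ≠ y' := by rintro rfl; exact htri _ _ _ hax hxy hyy'.symm
  have e3 : x' ≠ y' := by rintro rfl; exact htri _ _ _ hxy hyy' hxx'
  have hKay : ¬ K.Adj a y := fun h => htri _ _ _ hax hxy h
  have hKxd : ¬ K.Adj x d := fun h => htri _ _ _ hxy hyd h
  have hsw := h.switch hmem (a := a) (a' := x') (c := d) (d := y')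
    (by
      simp only [List.nodup_cons, List.mem_cons, List.not_mem_nil, not_or, or_false,
        not_false_eq_true, List.nodup_nil, and_true]
      exact ⟨⟨hxy.ne, hax.ne', hxx'.ne, hdx.symm, hy1.symm⟩, ⟨hay.symm, hx1.symm, hyd.ne, hyy'.ne⟩,
        ⟨hx2.symm, had, e2⟩, ⟨e1, e3⟩, hy2.symm⟩) hNx hNy
  refine ⟨hnd', by simpa using hlen, ?_, ?_⟩
  · rcases hsw with hsw | hsw
    · convert hsw using 1
      rw [← edgeSet_inj]
      ext e
      rw [hE']
      induction e with | _ u v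
      rw [mem_edgeSet (G := edgeSwitch K x y a d), edgeSwitch_adj, ← mem_edgeSet K, hE]
      have t1 := htail s(u, v)
      have t2 := hdisj s(u, v)
      have t3 := B.ne_of_adj (a := u) (b := v)
      have t4 : s(u, v) ∈ List.zipWith (fun a b : V => s(a, b)) (d :: ρ) (ρ ++ [a]) → u ≠ v := by
        intro ht
        exact K.ne_of_adj ((hE s(u, v)).2 (by tauto))
      have t5 : s(u, v) = s(a, y) → u ≠ v := by
        simp only [Sym2.eq_iff]; grind
      have t6 : s(u, v) = s(x, d) → u ≠ v := by
        simp only [Sym2.eq_iff]; grind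
      have t7 : s(y, x) = s(x, y) := Sym2.eq_swap
      have t8 : s(y, a) = s(a, y) := Sym2.eq_swap
      have t9 : s(x, a) = s(a, x) := Sym2.eq_swap
      have t10 : s(u, v) = s(x, y) → u ≠ v := by
        have := hxy.ne
        simp only [Sym2.eq_iff]; grind
      have t11 : s(a, x) ≠ s(x, y) := by simp [hay, hax.ne]
      have t12 : s(y, d) ≠ s(x, y) := by simp [hdx, hyd.ne', hxy.ne']
      have t13 : x ∈ s(a, x) := by simp
      have t14 : y ∈ s(y, d) := by simp
      rw [t7, t8, t9, mem_edgeSet]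
      rw [mem_edgeSet] at t2
      grind
    · exfalso
      have := h.cyclesGe hsw (a :: y :: d :: ρ)
        (by simp only [List.nodup_cons, List.mem_cons, not_or] at hnd ⊢; tauto) (by simp) (by
          simp only [cycleEdges_cons, List.cons_append, List.zipWith_cons_cons, List.mem_cons]
          rintro e (rfl | rfl | he)
          · rw [mem_edgeSet, edgeSwitch_adj]
            exact ⟨Or.inr (Or.inr Sym2.eq_swap), hay⟩
          · rw [mem_edgeSet, edgeSwitch_adj]
            refine ⟨Or.inl ⟨hyd, ?_, ?_⟩, hyd.ne⟩
            · simp [hxy.ne', hdx]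
            · simp [hy2.symm, hyy'.ne]
          · have ht := htail e he
            have hk := (hE e).2 (by tauto)
            induction e with | _ u v
            rw [mem_edgeSet, edgeSwitch_adj]
            refine ⟨Or.inl ⟨hk, ?_, ?_⟩, K.ne_of_adj hk⟩
            · intro h; rw [h] at ht; simp at ht
            · intro h; rw [h] at ht; simp at ht)
      simp only [List.length_cons] at this hlen
      omega
  · intro e he
    simp only [cycleEdges_cons, List.cons_append, List.zipWith_cons_cons, List.mem_cons] at he
    rcases he with rfl | rfl | rfl | he
    · exact fun hB => hKay ((hE _).2 (Or.inl hB))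
    · exact hdisj _ (by rw [Sym2.eq_swap]; simp)
    · exact fun hB => hKxd ((hE _).2 (Or.inl hB))
    · exact hdisj _ (by tauto)

end Config

section Permute
variable {V : Type*} {g : ℕ} {P : Bool → SimpleGraph V → Prop} {K B : SimpleGraph V} {b : Bool}
  {l l' : List V}

theorem Config.swap_append (h : SwitchClosed g P) (hg : 4 ≤ g) {pre suf : List V} {x y : V}
    (hc : Config P g b B (pre ++ x :: y :: suf)) : Config P g (!b) B (pre ++ y :: x :: suf) := by
  have hlen := hc.length_eq
  obtain ⟨d, m, hm⟩ : ∃ d m, suf ++ pre = d :: m := by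
    rcases hsp : suf ++ pre with _ | ⟨d, m⟩
    · have := congrArg List.length hsp
      simp only [List.length_append, List.length_cons, List.length_nil] at this hlen
      omega
    · exact ⟨d, m, rfl⟩
  have hm' : m ≠ [] := by
    rintro rfl
    have := congrArg List.length hm
    simp at this hlen
    omega
  obtain ⟨m, a, rfl⟩ := (List.eq_nil_or_concat m).resolve_left hm'
  have key : ∀ x y, (pre ++ x :: y :: suf) ~r (a :: x :: y :: d :: m) := by
    intro x y
    have h1 : (pre ++ x :: y :: suf) ~r ((x :: y :: suf) ++ pre) := List.isRotated_append
    have h2 : ((x :: y :: d :: m) ++ [a]) ~r ([a] ++ (x :: y :: d :: m)) := List.isRotated_append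
    have h3 : (x :: y :: suf) ++ pre = (x :: y :: d :: m) ++ [a] := by
      simp [hm]
    rw [h3] at h1
    exact h1.trans h2
  exact ((hc.of_isRotated (key x y)).swap h hg).of_isRotated (key y x).symm

theorem Config.exists_of_perm (h : SwitchClosed g P) (hg : 4 ≤ g) (hc : Config P g b B l)
    (hp : l.Perm l') : ∃ b', Config P g b' B l' := by
  have : ∀ pre : List V, (∃ b', Config P g b' B (pre ++ l)) → ∃ b', Config P g b' B (pre ++ l') := by
    clear hc
    induction hp with
    | nil => exact fun pre h => h
    | cons x _ ih =>
      intro pre hpre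
      have := ih (pre ++ [x])
      simp only [List.append_assoc, List.singleton_append] at this
      exact this hpre
    | swap x y l =>
      rintro pre ⟨b', hb'⟩
      exact ⟨_, hb'.swap_append h hg⟩
    | trans _ _ ih1 ih2 => exact fun pre hpre => ih2 pre (ih1 pre hpre)
  simpa using this [] ⟨b, hc⟩

theorem withCycle_adj_of_mem {u v : V} (h : s(u, v) ∈ cycleEdges l) (hl : l.Nodup)
    (h2 : 2 ≤ l.length) : (withCycle B l).Adj u v := by
  rw [← mem_edgeSet, edgeSet_withCycle hl h2]
  exact Or.inr h

theorem withCycle_adj_of_base {u v : V} (h : B.Adj u v) : (withCycle B l).Adj u v :=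
  Or.inl h

theorem withCycle_adj_of_notMem {u v : V} (hu : u ∉ l) :
    (withCycle B l).Adj u v ↔ B.Adj u v := by
  refine ⟨?_, Or.inl⟩
  rintro (h | h)
  · exact h
  · rw [fromEdgeSet_adj] at h
    exact absurd (mem_of_mem_cycleEdges h.1 (by simp)) hu

/-- No edge of `B` joins two vertices of the cycle. -/
theorem Config.not_adj (h : SwitchClosed g P) (hg : 4 ≤ g) (hc : Config P g b B l) {u v : V}
    (hu : u ∈ l) (hv : v ∈ l) : ¬ B.Adj u v := by
  intro huv
  obtain ⟨r, hr⟩ := exists_perm_append_of_subset (l := l) (s := [u, v]) (by simp [huv.ne])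
    (by simp [hu, hv])
  have hlen := hr.length_eq
  rw [hc.length_eq] at hlen
  rcases r with _ | ⟨w, r⟩
  · simp at hlen
    omega
  obtain ⟨b', hc'⟩ := hc.exists_of_perm h hg
    (hr.trans (List.Perm.cons u (List.Perm.swap w v r)))
  have hl := hc'.length_eq
  refine (h.cyclesGe hc'.mem).not_triangle hg (u := u) (v := w) (w := v)
    (withCycle_adj_of_mem ?_ hc'.nodup (by omega)) (withCycle_adj_of_mem ?_ hc'.nodup (by omega))
    (withCycle_adj_of_base huv) <;> simp [cycleEdges_cons]

theorem Config.five_le (h : SwitchClosed g P) (hg : 4 ≤ g) (hc : Config P g b B l) : 5 ≤ g := by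
  by_contra! hlt
  obtain rfl : g = 4 := by omega
  obtain ⟨w, x, y, z, rfl⟩ : ∃ w x y z, l = [w, x, y, z] := by
    have := hc.length_eq
    rcases l with _ | ⟨w, _ | ⟨x, _ | ⟨y, _ | ⟨z, _ | _⟩⟩⟩⟩ <;> simp at this
    exact ⟨w, x, y, z, rfl⟩
  have h1 := Config.swap_append h hg (pre := []) hc
  have h2 := Config.swap_append h hg (pre := [x]) h1
  have h3 := Config.swap_append h hg (pre := [x, y]) h2
  have h4 := h3.of_isRotated (l' := [w, x, y, z]) ⟨3, rfl⟩
  have := h4.mem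
  rw [Bool.not_not] at this
  exact h.not_both hc.mem this

/-- Each vertex of the cycle has at most one neighbour in `B`. -/
theorem Config.eq_of_adj (h : SwitchClosed g P) (hg : 4 ≤ g) (hc : Config P g b B l) {y c c' : V}
    (hy : y ∈ l) (h1 : B.Adj y c) (h2 : B.Adj y c') : c = c' := by
  obtain ⟨r, hr⟩ := exists_perm_append_of_subset (l := l) (s := [y]) (by simp) (by simp [hy])
  have hlen := hr.length_eq
  rw [hc.length_eq] at hlen
  rcases r with _ | ⟨u, _ | ⟨v, r⟩⟩
  · simp at hlen
    omega
  · simp at hlen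
    omega
  obtain ⟨b', hc'⟩ := hc.exists_of_perm h hg (hr.trans (List.Perm.swap u y (v :: r)))
  have hl := hc'.length_eq
  have e1 : (withCycle B (u :: y :: v :: r)).Adj y u :=
    (withCycle_adj_of_mem (by simp [cycleEdges_cons]) hc'.nodup (by omega)).symm
  have e2 : (withCycle B (u :: y :: v :: r)).Adj y v :=
    withCycle_adj_of_mem (by simp [cycleEdges_cons]) hc'.nodup (by omega)
  have hnd := hc'.nodup
  have huv : v ≠ u := by
    rintro rfl
    simp at hnd
  obtain ⟨w, -, -, hN⟩ := exists_third_neighbor (h.cubic hc'.mem y) e1 e2 huv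
  have hd : ∀ c, B.Adj y c → c = w := by
    intro c hyc
    have h3 := (hN c).1 (withCycle_adj_of_base hyc)
    rcases h3 with rfl | rfl | h3
    · exact absurd hyc (hc.not_adj h hg hy (hr.mem_iff.2 (by simp)))
    · exact absurd hyc (hc.not_adj h hg hy (hr.mem_iff.2 (by simp)))
    · exact h3
  rw [hd c h1, hd c' h2]

end Permute

section Gap
variable {V : Type*} {g : ℕ} {P : Bool → SimpleGraph V → Prop} {K B : SimpleGraph V} {b : Bool}
  {l l' : List V}

theorem withCycle_adj_imp {u v : V} (h : (withCycle B l).Adj u v) (h' : s(u, v) ∉ cycleEdges l) :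
    B.Adj u v := by
  rcases h with h | h
  · exact h
  · exact absurd ((fromEdgeSet_adj _).1 h).1 h'

/-- A walk of `B` with the cycle `l` that ends on the cycle has an initial segment in `B` that
reaches the cycle. -/
theorem exists_base_walk {r t : V} (p : (withCycle B l).Walk r t) (ht : t ∈ l) :
    ∃ k ∈ l, k ∈ p.support ∧ ∃ q : B.Walk r k, q.length ≤ p.length ∧
      (q.length = p.length → ∀ e ∈ p.edges, e ∉ cycleEdges l) := by
  induction p with
  | nil => exact ⟨_, ht, by simp, .nil, by simp, by simp⟩
  | @cons r r' t h p ih =>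
    by_cases hr : r ∈ l
    · exact ⟨r, hr, by simp, .nil, by simp, by simp⟩
    obtain ⟨k, hk, hkp, q, hq, hq'⟩ := ih ht
    refine ⟨k, hk, by simp [hkp], .cons ((withCycle_adj_of_notMem hr).1 h) q, by simpa, ?_⟩
    intro hlen e he
    rw [Walk.edges_cons, List.mem_cons] at he
    rcases he with rfl | he
    · exact fun h => hr (mem_of_mem_cycleEdges h (by simp))
    · exact hq' (by simpa using hlen) e he

theorem forall_mem_or_exists_base_walk {s t : V} (p : (withCycle B l).Walk s t) (hp : p.IsPath)
    (hs : s ∈ l) (ht : t ∈ l) :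
    (∀ e ∈ p.edges, e ∈ cycleEdges l) ∨ ∃ s' ∈ l, ∃ t' ∈ l, s' ≠ t' ∧ ∃ q : B.Walk s' t',
      q.length ≤ p.length ∧ (q.length = p.length → ∀ e ∈ p.edges, e ∉ cycleEdges l) := by
  induction p with
  | nil => simp
  | @cons s r t h p ih =>
    rw [Walk.cons_isPath_iff] at hp
    by_cases he : s(s, r) ∈ cycleEdges l
    · rcases ih hp.1 (mem_of_mem_cycleEdges he (by simp)) ht with h1 | h1
      · left
        simpa using ⟨he, h1⟩
      · obtain ⟨s', hs', t', ht', hne, q, hq, -⟩ := h1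
        refine Or.inr ⟨s', hs', t', ht', hne, q, by rw [Walk.length_cons]; omega, ?_⟩
        intro h
        rw [Walk.length_cons] at h
        omega
    · right
      obtain ⟨k, hk, hkp, q, hq, hq'⟩ := exists_base_walk p ht
      refine ⟨s, hs, k, hk, ?_, .cons (withCycle_adj_imp h he) q, by simpa, ?_⟩
      · rintro rfl
        exact hp.2 hkp
      · intro hlen e he'
        rw [Walk.edges_cons, List.mem_cons] at he'
        rcases he' with rfl | he'
        · exact he
        · exact hq' (by simpa using hlen) e he'

/-- A cycle through an edge `e` consists of `e` and a path between its ends. -/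
theorem exists_path_of_isCycle {v : V} {D : K.Walk v v} (hD : D.IsCycle) {e : Sym2 V}
    (he : e ∈ D.edges) : ∃ (i j : V) (p : K.Walk j i), e = s(i, j) ∧ p.IsPath ∧
      p.length + 1 = D.length ∧ ∀ e', e' ∈ D.edges ↔ e' = e ∨ e' ∈ p.edges := by
  classical
  induction e with | _ w x
  have hw : w ∈ D.support := D.fst_mem_support_of_mem_edges he
  have key : ∀ D' : K.Walk w w, D'.IsCycle → D'.length = D.length →
      (∀ e', e' ∈ D'.edges ↔ e' ∈ D.edges) → D'.snd = x →
      ∃ (i j : V) (p : K.Walk j i), s(w, x) = s(i, j) ∧ p.IsPath ∧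
      p.length + 1 = D.length ∧ ∀ e', e' ∈ D.edges ↔ e' = s(w, x) ∨ e' ∈ p.edges := by
    intro D' h1 h2 h3 h4
    rcases D' with _ | ⟨h, p⟩
    · exact absurd rfl h1.ne_nil
    rw [Walk.snd_cons] at h4
    subst h4
    refine ⟨w, _, p, rfl, ((Walk.cons_isCycle_iff _ _).1 h1).1, by simpa using h2, ?_⟩
    intro e'
    rw [← h3, Walk.edges_cons, List.mem_cons]
  have h1 : (D.rotate w hw).IsCycle := by simpa using hD
  have h3 : ∀ e', e' ∈ (D.rotate w hw).edges ↔ e' ∈ D.edges :=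
    fun e' => (D.rotate_edges w hw).mem_iff
  have hlen : (D.rotate w hw).length = D.length := by simp
  generalize D.rotate w hw = D' at h1 h3 hlen
  by_cases hx : D'.snd = x
  · exact key D' h1 hlen h3 hx
  · refine key D'.reverse h1.reverse (by simpa) (by simpa) ?_
    rw [← h3] at he
    rcases D' with _ | ⟨h, p⟩
    · exact absurd rfl h1.ne_nil
    have hp := ((Walk.cons_isCycle_iff _ _).1 h1).1
    rw [Walk.snd_cons] at hx
    rw [Walk.edges_cons, List.mem_cons] at he
    rcases he with he | he
    · rw [Sym2.eq_iff] at he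
      rcases he with ⟨-, he⟩ | ⟨he, -⟩
      · exact absurd he.symm hx
      · exact absurd he h.ne
    · rw [Walk.snd_reverse, Walk.penultimate_cons_of_not_nil]
      · exact (hp.eq_penultimate_of_mem_edges (Sym2.eq_swap ▸ he)).symm
      · intro hn
        rw [← Walk.length_eq_zero_iff, ← Walk.length_edges, List.length_eq_zero_iff] at hn
        simp [hn] at he

/-- A member of the two classes containing a `g`-cycle, two vertices of which are joined by a walk
of length `m` that avoids the edges of the cycle. -/
def HasGap (P : Bool → SimpleGraph V → Prop) (g m : ℕ) : Prop :=
  ∃ (b : Bool) (B : SimpleGraph V) (l : List V), Config P g b B l ∧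
    ∃ i ∈ l, ∃ j ∈ l, i ≠ j ∧ ∃ q : B.Walk i j, q.length = m

theorem withCycle_deleteEdges (hl : l.Nodup) (h2 : 2 ≤ l.length)
    (h : ∀ e ∈ cycleEdges l, e ∈ K.edgeSet) :
    withCycle (K.deleteEdges {e | e ∈ cycleEdges l}) l = K := by
  rw [← edgeSet_inj, edgeSet_withCycle hl h2, edgeSet_deleteEdges]
  exact Set.sdiff_union_of_subset h

theorem config_deleteEdges (hK : P b K) (hl : l.Nodup) (h2 : 2 ≤ l.length) (hlg : l.length = g)
    (h : ∀ e ∈ cycleEdges l, e ∈ K.edgeSet) :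
    Config P g b (K.deleteEdges {e | e ∈ cycleEdges l}) l := by
  refine ⟨hl, hlg, ?_, ?_⟩
  · rwa [withCycle_deleteEdges hl h2 h]
  · intro e he
    rw [edgeSet_deleteEdges]
    exact fun h => h.2 he

theorem Config.exists_hasGap (hc : Config P g b B l) {v : V}
    {D : (withCycle B l).Walk v v} (hD : D.IsCycle) (hlen : D.length = g + 1) {e : Sym2 V}
    (he : e ∈ D.edges) (hel : e ∈ cycleEdges l) : ∃ m, HasGap P g m := by
  obtain ⟨i, j, p, rfl, hp, -, hpe⟩ := exists_path_of_isCycle hD he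
  rcases forall_mem_or_exists_base_walk p hp (mem_of_mem_cycleEdges hel (by simp))
    (mem_of_mem_cycleEdges hel (by simp)) with h | ⟨s, hs, t, ht, hne, q, -⟩
  · exfalso
    have hsub : D.edges ⊆ cycleEdges l := by
      intro e' he'
      rcases (hpe e').1 he' with rfl | he'
      · exact hel
      · exact h e' he'
    have := (List.subperm_of_subset hD.edges_nodup hsub).length_le
    rw [Walk.length_edges, length_cycleEdges, hc.length_eq] at this
    omega
  · exact ⟨_, b, B, l, hc, s, hs, t, ht, hne, q, rfl⟩

end Gap

section Count
variable {V : Type*} {g : ℕ} {P : Bool → SimpleGraph V → Prop} {K L B : SimpleGraph V} {b : Bool}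
  {l l' : List V}

/-- The edge sets of the cycles of length `k` in `K`. -/
def cycleSets (K : SimpleGraph V) (k : ℕ) : Set (Set (Sym2 V)) :=
  {S | ∃ (v : V) (D : K.Walk v v), D.IsCycle ∧ D.length = k ∧ S = {e | e ∈ D.edges}}

/-- The edge sets of the paths of length `k` in `K` joining the ends of `e`. -/
def pathSets (K : SimpleGraph V) (k : ℕ) (e : Sym2 V) : Set (Set (Sym2 V)) :=
  {S | ∃ (i j : V) (q : K.Walk i j), e = s(i, j) ∧ q.IsPath ∧ q.length = k ∧
    S = {e | e ∈ q.edges}}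

theorem ncard_cycleSets_le_of_iso [Finite V] (φ : K ≃g L) (k : ℕ) :
    (cycleSets K k).ncard ≤ (cycleSets L k).ncard := by
  refine Set.ncard_le_ncard_of_injOn (fun S => Sym2.map φ '' S) ?_
    (Set.image_injective.2 (Sym2.map.injective φ.injective)).injOn (Set.toFinite _)
  rintro S ⟨v, D, hD, hlen, rfl⟩
  refine ⟨_, D.map φ.toHom, hD.map φ.injective, by simpa, ?_⟩
  ext e
  simp [Walk.edges_map]

theorem ncard_cycleSets_eq_of_iso [Finite V] (φ : K ≃g L) (k : ℕ) :
    (cycleSets K k).ncard = (cycleSets L k).ncard :=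
  (ncard_cycleSets_le_of_iso φ k).antisymm (ncard_cycleSets_le_of_iso φ.symm k)

/-- The cycle through the vertices of `l`, as a graph. -/
def cycleOf (l : List V) : SimpleGraph V :=
  fromEdgeSet {e | e ∈ cycleEdges l}

theorem ncard_cycleSets_cycleOf_map [Finite V] (σ : Equiv.Perm V) (l : List V) (k : ℕ) :
    (cycleSets (cycleOf (l.map σ)) k).ncard = (cycleSets (cycleOf l) k).ncard := by
  refine (ncard_cycleSets_eq_of_iso (⟨σ, ?_⟩ : cycleOf l ≃g cycleOf (l.map σ)) k).symm
  intro u v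
  simp only [cycleOf, fromEdgeSet_adj, Set.mem_ofPred_eq, cycleEdges_map, ← Sym2.map_mk,
    List.mem_map_of_injective (Sym2.map.injective σ.injective), σ.injective.ne_iff]

theorem mem_edgeSet_of_mem_pathSets {M : ℕ} {e e' : Sym2 V} {S : Set (Sym2 V)}
    (hS : S ∈ pathSets B M e) (he : e' ∈ S) : e' ∈ B.edgeSet := by
  obtain ⟨i, j, q, -, -, -, rfl⟩ := hS
  exact q.edges_subset_edgeSet he

theorem cycleSets_withCycle {M : ℕ} (hc : Config P g b B l) (hg : 4 ≤ g)
    (hmin : ∀ i ∈ l, ∀ j ∈ l, i ≠ j → ∀ q : B.Walk i j, M ≤ q.length) :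
    cycleSets (withCycle B l) (M + 1) = cycleSets B (M + 1) ∪ cycleSets (cycleOf l) (M + 1) ∪
      ⋃ e ∈ cycleEdges l, insert e '' pathSets B M e := by
  apply Set.Subset.antisymm
  · rintro S ⟨v, D, hD, hlen, rfl⟩
    by_cases hD' : ∀ e ∈ D.edges, e ∉ cycleEdges l
    · have hB : ∀ e ∈ D.edges, e ∈ B.edgeSet := by
        intro e he
        have := D.edges_subset_edgeSet he
        have h' := hD' e he
        induction e with | _ u v
        exact withCycle_adj_imp this h'
      exact Or.inl (Or.inl ⟨v, D.transfer B hB, hD.transfer hB, by simpa, by simp⟩)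
    push Not at hD'
    obtain ⟨e, he, hel⟩ := hD'
    obtain ⟨i, j, p, rfl, hp, hpl, hpe⟩ := exists_path_of_isCycle hD he
    rcases forall_mem_or_exists_base_walk p hp (mem_of_mem_cycleEdges hel (by simp))
      (mem_of_mem_cycleEdges hel (by simp)) with h | ⟨s, hs, t, ht, hne, q, hq, hq'⟩
    · have hZ : ∀ e ∈ D.edges, e ∈ (cycleOf l).edgeSet := by
        intro e he
        rw [cycleOf, edgeSet_fromEdgeSet]
        refine ⟨?_, ?_⟩
        · rcases (hpe e).1 he with rfl | he
          · exact hel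
          · exact h e he
        · exact (withCycle B l).not_isDiag_of_mem_edgeSet (D.edges_subset_edgeSet he)
      exact Or.inl (Or.inr ⟨v, D.transfer _ hZ, hD.transfer hZ, by simpa, by simp⟩)
    · have := hmin s hs t ht hne q
      have hpZ := hq' (by omega)
      have hB : ∀ e ∈ p.edges, e ∈ B.edgeSet := by
        intro e he
        have := p.edges_subset_edgeSet he
        have h' := hpZ e he
        induction e with | _ u v
        exact withCycle_adj_imp this h'
      refine Or.inr (Set.mem_biUnion hel ⟨{e | e ∈ p.edges}, ⟨j, i, p.transfer B hB, Sym2.eq_swap,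
        hp.transfer hB, by simp; omega, by simp⟩, ?_⟩)
      ext e
      simp only [Set.mem_insert_iff, Set.mem_ofPred_eq, hpe]
  · have hle1 : B ≤ withCycle B l := le_sup_left
    have hle2 : cycleOf l ≤ withCycle B l := le_sup_right
    rintro S ((⟨v, D, hD, hlen, rfl⟩ | ⟨v, D, hD, hlen, rfl⟩) | hS)
    · exact ⟨v, D.mapLe hle1, hD.mapLe _, by simpa, by simp⟩
    · exact ⟨v, D.mapLe hle2, hD.mapLe _, by simpa, by simp⟩
    · simp only [Set.mem_iUnion] at hS
      obtain ⟨e, he, S', ⟨i, j, q, rfl, hq, hlen, rfl⟩, rfl⟩ := hS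
      have hadj : (withCycle B l).Adj j i :=
        (withCycle_adj_of_mem he hc.nodup (by rw [hc.length_eq]; omega)).symm
      refine ⟨j, .cons hadj (q.mapLe hle1), ?_, by simpa, ?_⟩
      · rw [Walk.cons_isCycle_iff]
        refine ⟨hq.mapLe _, fun h => hc.disj _ he ?_⟩
        rw [Walk.edges_mapLe_eq_edges, Sym2.eq_swap] at h
        exact q.edges_subset_edgeSet h
      · ext e
        simp [Sym2.eq_swap (a := i)]

theorem ncard_biUnion_insert_pathSets [Finite V] {M : ℕ} {E : List (Sym2 V)} (hE : E.Nodup)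
    (hd : ∀ e ∈ E, e ∉ B.edgeSet) :
    (⋃ e ∈ E, insert e '' pathSets B M e).ncard =
      (E.map fun e => (pathSets B M e).ncard).sum := by
  induction E with
  | nil => simp
  | cons e E ih =>
    simp only [List.mem_cons, forall_eq_or_imp, List.nodup_cons] at hd hE
    have h1 : (⋃ e' ∈ e :: E, insert e' '' pathSets B M e') =
        insert e '' pathSets B M e ∪ ⋃ e' ∈ E, insert e' '' pathSets B M e' := by
      ext S
      simp only [List.mem_cons, Set.mem_iUnion, Set.mem_union, exists_prop, or_and_right, exists_or,
        exists_eq_left]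
    rw [h1, Set.ncard_union_eq _ (Set.toFinite _) (Set.toFinite _), ih hE.2 hd.2, List.map_cons,
      List.sum_cons, Set.InjOn.ncard_image]
    · intro S hS S' hS' h
      have hn : ∀ S ∈ pathSets B M e, e ∉ S := fun S hS he =>
        hd.1 (mem_edgeSet_of_mem_pathSets hS he)
      rw [← Set.insert_sdiff_self_of_notMem (hn S hS), ← Set.insert_sdiff_self_of_notMem (hn S' hS')]
      exact congrArg (· \ {e}) h
    · rw [Set.disjoint_left]
      rintro _ ⟨S, hS, rfl⟩ h
      simp only [Set.mem_iUnion] at h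
      obtain ⟨e', he', S', hS', h⟩ := h
      have : e ∈ insert e' S' := h ▸ Set.mem_insert e S
      rcases this with rfl | this
      · exact hE.1 he'
      · exact hd.1 (mem_edgeSet_of_mem_pathSets hS' this)

/-- The number of paths of length `M` in `B` that join consecutive vertices of the cycle. -/
noncomputable def pathCount (B : SimpleGraph V) (M : ℕ) (l : List V) : ℕ :=
  ((cycleEdges l).map fun e => (pathSets B M e).ncard).sum

theorem ncard_cycleSets_withCycle [Finite V] {M : ℕ} (hM : 1 ≤ M) (hc : Config P g b B l)
    (hg : 4 ≤ g) (hmin : ∀ i ∈ l, ∀ j ∈ l, i ≠ j → ∀ q : B.Walk i j, M ≤ q.length) :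
    (cycleSets (withCycle B l) (M + 1)).ncard =
      (cycleSets B (M + 1)).ncard + (cycleSets (cycleOf l) (M + 1)).ncard + pathCount B M l := by
  have hZ : ∀ S ∈ cycleSets (cycleOf l) (M + 1), ∀ e ∈ S, e ∈ cycleEdges l := by
    rintro S ⟨v, D, -, -, rfl⟩ e he
    have := D.edges_subset_edgeSet he
    rw [cycleOf, edgeSet_fromEdgeSet] at this
    exact this.1
  have hB : ∀ S ∈ cycleSets B (M + 1), ∀ e ∈ S, e ∈ B.edgeSet := by
    rintro S ⟨v, D, -, -, rfl⟩ e he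
    exact D.edges_subset_edgeSet he
  have hne : ∀ {K : SimpleGraph V} {i j : V} (q : K.Walk i j), 1 ≤ q.length →
      ∃ e, e ∈ q.edges := by
    intro K i j q hq
    rw [← q.length_edges] at hq
    exact List.exists_mem_of_length_pos hq
  rw [cycleSets_withCycle hc hg hmin, Set.ncard_union_eq _ (Set.toFinite _) (Set.toFinite _),
    Set.ncard_union_eq _ (Set.toFinite _) (Set.toFinite _), ncard_biUnion_insert_pathSets
    (nodup_cycleEdges hc.nodup (by rw [hc.length_eq]; omega)) hc.disj, pathCount]
  · rw [Set.disjoint_left]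
    intro S hS hS'
    have h1 := hB S hS
    have h2 := hZ S hS'
    obtain ⟨v, D, -, hlen, rfl⟩ := hS
    obtain ⟨e, he⟩ := hne D (by omega)
    exact hc.disj e (h2 e he) (h1 e he)
  · rw [Set.disjoint_left]
    intro S hS hS'
    simp only [Set.mem_iUnion] at hS'
    obtain ⟨e, he, S', hS', rfl⟩ := hS'
    rcases hS with hS | hS
    · exact hc.disj e he (hB _ hS e (Set.mem_insert _ _))
    · obtain ⟨e', he'⟩ : ∃ e', e' ∈ S' := by
        obtain ⟨i, j, q, -, -, hlen, rfl⟩ := hS'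
        exact hne q (by omega)
      exact hc.disj e' (hZ _ hS e' (Set.mem_insert_of_mem _ he'))
        (mem_edgeSet_of_mem_pathSets hS' he')

theorem pathCount_eq [Finite V] {M : ℕ} (h : SwitchClosed g P) (hg : 4 ≤ g) (hM : 1 ≤ M)
    (hc : Config P g b B l) (hc' : Config P g b B l') (hl : ∀ v, v ∈ l' ↔ v ∈ l)
    (hmin : ∀ i ∈ l, ∀ j ∈ l, i ≠ j → ∀ q : B.Walk i j, M ≤ q.length)
    (hZ : (cycleSets (cycleOf l') (M + 1)).ncard = (cycleSets (cycleOf l) (M + 1)).ncard) :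
    pathCount B M l = pathCount B M l' := by
  obtain ⟨φ⟩ := h.iso hc.mem hc'.mem
  have h1 := ncard_cycleSets_eq_of_iso φ (M + 1)
  rw [ncard_cycleSets_withCycle hM hc hg hmin,
    ncard_cycleSets_withCycle hM hc' hg (by simpa only [hl] using hmin), hZ] at h1
  omega

end Count

section Degree
variable {V : Type*} {g : ℕ} {P : Bool → SimpleGraph V → Prop} {B : SimpleGraph V} {b : Bool}
  {l : List V} {M : ℕ}

theorem Config.length_add_two_ge (hc : Config P g b B l) (hg : 4 ≤ g)
    (hmin : ∀ m, HasGap P g m → M ≤ m) {i j p x y o q : V} (R : B.Walk i p) (hpx : B.Adj p x)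
    (Q : B.Walk q j) (hnd : (R.support ++ x :: y :: Q.support).Nodup) (hop : o ≠ p)
    (hx : x ∉ l) (hy : y ∉ l) (hi : i ∈ l) (hj : j ∈ l)
    (hP : P (!b) (edgeSwitch (withCycle B l) x y o q)) : M ≤ R.length + 2 + Q.length := by
  have hl := hc.length_eq
  rw [List.nodup_append] at hnd
  obtain ⟨-, hQ, hRQ⟩ := hnd
  simp only [List.nodup_cons, List.mem_cons, not_or] at hQ
  have hxR : x ∉ R.support := fun h => hRQ x h x (by simp) rfl
  have hyR : y ∉ R.support := fun h => hRQ y h y (by simp) rfl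
  have hcyc : ∀ e ∈ cycleEdges l, e ∈ (edgeSwitch (withCycle B l) x y o q).edgeSet := by
    intro e he
    have hxe : x ∉ e := fun h => hx (mem_of_mem_cycleEdges he h)
    have hye : y ∉ e := fun h => hy (mem_of_mem_cycleEdges he h)
    induction e with | _ u v
    have huv := withCycle_adj_of_mem (B := B) he hc.nodup (by omega)
    rw [mem_edgeSet, edgeSwitch_adj]
    refine ⟨Or.inl ⟨huv, ?_, ?_⟩, huv.ne⟩
    · intro h
      exact hxe (h ▸ by simp)
    · intro h
      exact hye (h ▸ by simp)
  have hc' := config_deleteEdges hP hc.nodup (by omega) hl hcyc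
  have hout : ∀ u v, s(u, v) ∉ cycleEdges l → (edgeSwitch (withCycle B l) x y o q).Adj u v →
      ((edgeSwitch (withCycle B l) x y o q).deleteEdges {e | e ∈ cycleEdges l}).Adj u v := by
    intro u v h1 h2
    rw [deleteEdges_adj]
    exact ⟨h2, h1⟩
  have hwalk : ∀ {u v : V} (W : B.Walk u v), x ∉ W.support → y ∉ W.support → ∀ e ∈ W.edges,
      e ∈ ((edgeSwitch (withCycle B l) x y o q).deleteEdges {e | e ∈ cycleEdges l}).edgeSet := by
    intro u v W h1 h2 e he
    have heB := W.edges_subset_edgeSet he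
    induction e with | _ u v
    refine hout u v (fun h => hc.disj _ h heB) ?_
    have hu := W.fst_mem_support_of_mem_edges he
    have hv := W.snd_mem_support_of_mem_edges he
    rw [edgeSwitch_adj]
    refine ⟨Or.inl ⟨withCycle_adj_of_base heB, ?_, ?_⟩, B.ne_of_adj heB⟩
    · intro h
      rw [Sym2.eq_iff] at h
      grind
    · intro h
      rw [Sym2.eq_iff] at h
      grind
  have hpy : p ≠ y := fun h => hyR (h ▸ R.end_mem_support)
  have hqx : q ≠ x := fun h => hQ.1.2 (h ▸ Q.start_mem_support)
  have e1 := hout p x (fun h => hx (mem_of_mem_cycleEdges h (by simp))) (by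
    rw [edgeSwitch_adj]
    refine ⟨Or.inl ⟨withCycle_adj_of_base hpx, ?_, ?_⟩, hpx.ne⟩
    · intro h
      rw [Sym2.eq_iff] at h
      grind
    · intro h
      rw [Sym2.eq_iff] at h
      grind)
  have e2 := hout x q (fun h => hx (mem_of_mem_cycleEdges h (by simp))) (by
    rw [edgeSwitch_adj]
    exact ⟨Or.inr (Or.inl rfl), hqx.symm⟩)
  refine hmin _ ⟨_, _, _, hc', i, hi, j, hj, ?_,
    (R.transfer _ (hwalk R hxR hyR)).append (.cons e1 (.cons e2 (Q.transfer _
      (hwalk Q hQ.1.2 hQ.2.1)))), ?_⟩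
  · exact hRQ i R.start_mem_support j (by simp)
  · simp only [Walk.length_append, Walk.length_transfer, Walk.length_cons]
    omega

theorem Config.eq_of_paths (h : SwitchClosed g P) (hg : 4 ≤ g) (hc : Config P g b B l)
    (hmin : ∀ m, HasGap P g m → M ≤ m) {i j j' p x y : V} (R : B.Walk i p) (hpx : B.Adj p x)
    (hxy : B.Adj x y) (Q : B.Walk y j) (Q' : B.Walk y j') (hQ : R.length + 2 + Q.length = M)
    (hQ' : Q'.length = Q.length) (hn : (R.support ++ x :: Q.support).Nodup)
    (hn' : (R.support ++ x :: Q'.support).Nodup) (hi : i ∈ l) (hj : j ∈ l) (hj' : j' ∈ l) :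
    j = j' := by
  induction Q generalizing p x with
  | nil => exact Walk.eq_of_length_eq_zero hQ'
  | @cons y q j hyq Q ih =>
    rcases Q' with _ | @⟨_, q', _, hyq', Q'⟩
    · simp at hQ'
    rw [Walk.length_cons] at hQ
    rw [Walk.length_cons, Walk.length_cons, Nat.add_right_cancel_iff] at hQ'
    rw [Walk.support_cons] at hn hn'
    by_cases hqq : q = q'
    · subst hqq
      refine ih (R.concat hpx) hxy hyq Q' ?_ hQ' ?_ ?_ hj
      · rw [Walk.length_concat]
        omega
      · simpa [Walk.support_concat] using hn
      · simpa [Walk.support_concat] using hn'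
    exfalso
    have hm := hn
    have hm' := hn'
    rw [List.nodup_append] at hm hm'
    obtain ⟨-, h1, h2⟩ := hm
    obtain ⟨-, h1', h2'⟩ := hm'
    simp only [List.nodup_cons, List.mem_cons, not_or] at h1 h1'
    have hxl : x ∉ l := by
      intro hx
      have := hmin _ ⟨_, _, _, hc, i, hi, x, hx, h2 i R.start_mem_support x (by simp),
        R.concat hpx, rfl⟩
      rw [Walk.length_concat] at this
      omega
    have hyl : y ∉ l := by
      intro hy
      have := hmin _ ⟨_, _, _, hc, i, hi, y, hy, h2 i R.start_mem_support y (by simp),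
        (R.concat hpx).concat hxy, rfl⟩
      rw [Walk.length_concat, Walk.length_concat] at this
      omega
    have hpy : p ≠ y := h2 p R.end_mem_support y (by simp)
    have hpq : p ≠ q := h2 p R.end_mem_support q (by simp)
    have hpq' : p ≠ q' := h2' p R.end_mem_support q' (by simp)
    have hxq : x ≠ q := by rintro rfl; exact h1.1.2 Q.start_mem_support
    have hxq' : x ≠ q' := by rintro rfl; exact h1'.1.2 Q'.start_mem_support
    have hK := h.cubic hc.mem
    obtain ⟨o, hoy, hop, ho⟩ := exists_third_neighbor (hK x) (withCycle_adj_of_base hxy)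
      (withCycle_adj_of_base hpx.symm) hpy
    obtain ⟨q'', -, -, hq''⟩ := exists_third_neighbor (hK y) (withCycle_adj_of_base hxy.symm)
      (withCycle_adj_of_base hyq) hxq.symm
    have e := (hq'' q').1 (withCycle_adj_of_base hyq')
    obtain rfl : q' = q'' := by grind
    have hxo : (withCycle B l).Adj x o := (ho o).2 (by simp)
    have htri : ∀ v, (withCycle B l).Adj y v → o ≠ v := by
      rintro v hv rfl
      exact (h.cyclesGe hc.mem).not_triangle hg (withCycle_adj_of_base hxy) hv hxo
    have hoq := htri q (withCycle_adj_of_base hyq)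
    have hoq' := htri q' (withCycle_adj_of_base hyq')
    rcases h.switch (x := x) (y := y) (a := o) (a' := p) (c := q) (d := q') hc.mem (by
      have := hxo.ne
      have := hpx.ne
      have := hyq.ne
      have := hyq'.ne
      grind) (fun v => by rw [ho v]; tauto) hq'' with hP | hP
    · have := hc.length_add_two_ge hg hmin R hpx Q hn hop hxl hyl hi hj hP
      omega
    · have := hc.length_add_two_ge hg hmin R hpx Q' hn' hop hxl hyl hi hj' hP
      omega

theorem Config.eq_or_eq_or_eq_of_pathSets (h : SwitchClosed g P) (hg : 4 ≤ g)
    (hc : Config P g b B l) (hmin : ∀ m, HasGap P g m → M ≤ m) {i j₁ j₂ j₃ : V} (hi : i ∈ l)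
    (hj₁ : j₁ ∈ l) (hj₂ : j₂ ∈ l) (hj₃ : j₃ ∈ l) (h₁ : i ≠ j₁) (h₂ : i ≠ j₂) (h₃ : i ≠ j₃)
    (hp₁ : (pathSets B M s(i, j₁)).Nonempty) (hp₂ : (pathSets B M s(i, j₂)).Nonempty)
    (hp₃ : (pathSets B M s(i, j₃)).Nonempty) : j₁ = j₂ ∨ j₁ = j₃ ∨ j₂ = j₃ := by
  have key : ∀ j, j ∈ l → i ≠ j → (pathSets B M s(i, j)).Nonempty →
      ∃ (x y : V) (hix : B.Adj i x) (hxy : B.Adj x y) (Q : B.Walk y j), 2 + Q.length = M ∧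
        ([i] ++ x :: Q.support).Nodup := by
    rintro j hj hij ⟨S, i', j', q, he, hq, hlen, -⟩
    obtain ⟨q, hq, hlen⟩ : ∃ q : B.Walk i j, q.IsPath ∧ q.length = M := by
      rcases Sym2.eq_iff.1 he with ⟨rfl, rfl⟩ | ⟨rfl, rfl⟩
      · exact ⟨q, hq, hlen⟩
      · exact ⟨q.reverse, hq.reverse, by simpa⟩
    rcases q with _ | @⟨_, x, _, hix, q⟩
    · exact absurd rfl hij
    rcases q with _ | @⟨_, y, _, hxy, q⟩
    · exact absurd hix (hc.not_adj h hg hi hj)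
    refine ⟨x, y, hix, hxy, q, ?_, ?_⟩
    · rw [← hlen, Walk.length_cons, Walk.length_cons]
      omega
    · simpa [Walk.isPath_def] using hq
  obtain ⟨x, y₁, hix, hxy₁, Q₁, hl₁, hn₁⟩ := key j₁ hj₁ h₁ hp₁
  obtain ⟨x₂, y₂, hix₂, hxy₂, Q₂, hl₂, hn₂⟩ := key j₂ hj₂ h₂ hp₂
  obtain ⟨x₃, y₃, hix₃, hxy₃, Q₃, hl₃, hn₃⟩ := key j₃ hj₃ h₃ hp₃
  obtain rfl := hc.eq_of_adj h hg hi hix hix₂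
  obtain rfl := hc.eq_of_adj h hg hi hix hix₃
  have hne : ∀ {j y} (Q : B.Walk y j), ([i] ++ x :: Q.support).Nodup → y ≠ i := by
    rintro j y Q hn rfl
    simp at hn
  by_cases h12 : y₁ = y₂
  · subst h12
    exact Or.inl (hc.eq_of_paths h hg hmin .nil hix hxy₁ Q₁ Q₂ (by simpa) (by omega) hn₁ hn₂ hi
      hj₁ hj₂)
  have hK := h.cubic hc.mem x
  obtain ⟨y, -, -, hy⟩ := exists_third_neighbor hK (withCycle_adj_of_base hxy₁)
      (withCycle_adj_of_base hix.symm) (hne Q₁ hn₁).symm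
  have e2 := (hy y₂).1 (withCycle_adj_of_base hxy₂)
  have e3 := (hy y₃).1 (withCycle_adj_of_base hxy₃)
  have := hne Q₂ hn₂
  have := hne Q₃ hn₃
  have h3 : y₃ = y₁ ∨ y₃ = y₂ := by grind
  rcases h3 with rfl | rfl
  · exact Or.inr (Or.inl (hc.eq_of_paths h hg hmin .nil hix hxy₁ Q₁ Q₃ (by simpa) (by omega) hn₁
      hn₃ hi hj₁ hj₃))
  · exact Or.inr (Or.inr (hc.eq_of_paths h hg hmin .nil hix hxy₂ Q₂ Q₃ (by simpa) (by omega) hn₂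
      hn₃ hi hj₂ hj₃))

end Degree

section Exchange
variable {V : Type*} {g : ℕ} {P : Bool → SimpleGraph V → Prop} {B : SimpleGraph V} {b : Bool}
  {l l' : List V} {M : ℕ}

theorem exists_equiv_map_of_perm (h : l.Perm l') (hl : l.Nodup) :
    ∃ σ : Equiv.Perm V, l' = l.map σ ∧ ∀ v ∉ l, σ v = v := by
  classical
  induction h with
  | nil => exact ⟨1, by simp, by simp⟩
  | cons x _ ih =>
    rw [List.nodup_cons] at hl
    obtain ⟨σ, rfl, hσ⟩ := ih hl.2
    refine ⟨σ, by rw [List.map_cons, hσ x hl.1], fun v hv => hσ v ?_⟩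
    simp only [List.mem_cons, not_or] at hv
    exact hv.2
  | swap x y l =>
    simp only [List.nodup_cons, List.mem_cons, not_or] at hl
    refine ⟨Equiv.swap x y, ?_, ?_⟩
    · simp only [List.map_cons, Equiv.swap_apply_left, Equiv.swap_apply_right, List.cons.injEq,
        true_and]
      refine (List.map_id'' (fun _ => rfl) l).symm.trans (List.map_congr_left fun v hv => ?_)
      rw [Equiv.swap_apply_of_ne_of_ne]
      · rintro rfl
        exact hl.2.1 hv
      · rintro rfl
        exact hl.1.2 hv
    · intro v hv
      simp only [List.mem_cons, not_or] at hv
      exact Equiv.swap_apply_of_ne_of_ne hv.2.1 hv.1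
  | trans h1 _ ih1 ih2 =>
    obtain ⟨σ, rfl, hσ⟩ := ih1 hl
    obtain ⟨τ, rfl, hτ⟩ := ih2 (h1.nodup_iff.1 hl)
    refine ⟨τ * σ, by simp, fun v hv => ?_⟩
    rw [Equiv.Perm.mul_apply, hσ v hv, hτ v (mt h1.mem_iff.2 hv)]

theorem pathCount_eq_of_perm [Finite V] (h : SwitchClosed g P) (hg : 4 ≤ g) (hM : 1 ≤ M)
    (hc : Config P g b B l) (hc' : Config P g b B l') (hl : l.Perm l')
    (hmin : ∀ m, HasGap P g m → M ≤ m) : pathCount B M l = pathCount B M l' := by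
  obtain ⟨σ, hσ, -⟩ := exists_equiv_map_of_perm hl hc.nodup
  refine pathCount_eq h hg hM hc hc' (fun v => hl.mem_iff.symm)
    (fun i hi j hj hij q => hmin _ ⟨_, _, _, hc, i, hi, j, hj, hij, q, rfl⟩) ?_
  rw [hσ, ncard_cycleSets_cycleOf_map]

theorem Config.ncard_pathSets_exchange [Finite V] (h : SwitchClosed g P) (hg : 4 ≤ g)
    (hc : Config P g b B l) (hM : 1 ≤ M) (hmin : ∀ m, HasGap P g m → M ≤ m) {u v w x : V}
    (hnd : [u, v, w, x].Nodup) (hsub : [u, v, w, x] ⊆ l) :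
    (pathSets B M s(u, v)).ncard + (pathSets B M s(w, x)).ncard =
        (pathSets B M s(u, w)).ncard + (pathSets B M s(v, x)).ncard ∧
      (pathSets B M s(u, v)).ncard + (pathSets B M s(w, x)).ncard =
        (pathSets B M s(u, x)).ncard + (pathSets B M s(v, w)).ncard := by
  obtain ⟨r, hr⟩ := exists_perm_append_of_subset (l := l) hnd hsub
  have h5 := hc.five_le h hg
  have hlen := hr.length_eq
  rw [hc.length_eq] at hlen
  rcases r with _ | ⟨y, r⟩
  · simp at hlen
    omega
  obtain ⟨b', h1⟩ := hc.exists_of_perm h hg hr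
  have h2 : Config P g (!b') B (u :: w :: v :: x :: y :: r) := h1.swap_append h hg (pre := [u])
  have h3 : Config P g (!!b') B (u :: w :: x :: v :: y :: r) := h2.swap_append h hg (pre := [u, w])
  have h4 : Config P g (!!!b') B (u :: x :: w :: v :: y :: r) := h3.swap_append h hg (pre := [u])
  have h5 : Config P g (!!!!b') B (u :: x :: v :: w :: y :: r) :=
    h4.swap_append h hg (pre := [u, x])
  have h6 : Config P g (!!!!!b') B (u :: v :: x :: w :: y :: r) := h5.swap_append h hg (pre := [u])
  simp only [Bool.not_not] at h3 h4 h5 h6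
  have e13 := pathCount_eq_of_perm h hg hM h1 h3
    (.cons u ((List.Perm.swap w v _).trans (.cons w (.swap x v _)))) hmin
  have e35 := pathCount_eq_of_perm h hg hM h3 h5
    (.cons u ((List.Perm.swap x w _).trans (.cons x (.swap v w _)))) hmin
  have e24 := pathCount_eq_of_perm h hg hM h2 h4
    (.cons u ((List.Perm.cons w (.swap x v _)).trans (.swap x w _))) hmin
  have e46 := pathCount_eq_of_perm h hg hM h4 h6
    (.cons u ((List.Perm.cons x (.swap v w _)).trans (.swap v x _))) hmin
  simp only [pathCount, cycleEdges_cons, List.cons_append, List.nil_append,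
    List.zipWith_cons_cons, List.map_cons, List.sum_cons] at e13 e35 e24 e46
  rw [Sym2.eq_swap (a := w) (b := v), Sym2.eq_swap (a := x) (b := v),
    Sym2.eq_swap (a := x) (b := w)] at *
  omega

theorem not_hasGap [Finite V] (h : SwitchClosed g P) (hg : 4 ≤ g) (m : ℕ) : ¬ HasGap P g m := by
  classical
  intro hm
  have hex : ∃ m, HasGap P g m := ⟨m, hm⟩
  obtain ⟨M, hM, hmin⟩ : ∃ M, HasGap P g M ∧ ∀ m, HasGap P g m → M ≤ m :=
    ⟨Nat.find hex, Nat.find_spec hex, fun m hm => Nat.find_min' hex hm⟩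
  obtain ⟨b, B, l, hc, u, hu, v, hv, huv, q, hq⟩ := hM
  have hM1 : 1 ≤ M := by
    by_contra! h0
    exact huv (Walk.eq_of_length_eq_zero (p := q) (by omega))
  have hpos : ∀ e, (pathSets B M e).Nonempty ↔ 0 < (pathSets B M e).ncard := fun e =>
    (Set.ncard_pos (Set.toFinite _)).symm
  have huv' : 0 < (pathSets B M s(u, v)).ncard := by
    rw [← hpos]
    refine ⟨_, u, v, q.bypass, rfl, q.bypass_isPath, ?_, rfl⟩
    exact (hq ▸ q.length_bypass_le_length).antisymm
      (hmin _ ⟨_, _, _, hc, u, hu, v, hv, huv, q.bypass, rfl⟩)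
  obtain ⟨r, hr⟩ := exists_perm_append_of_subset (l := l) (s := [u, v]) (by simpa)
    (by simp [hu, hv])
  have h5 := hc.five_le h hg
  have hlen := hr.length_eq
  rw [hc.length_eq] at hlen
  obtain ⟨w, x, y, r, rfl⟩ : ∃ w x y r', r = w :: x :: y :: r' := by
    rcases r with _ | ⟨w, _ | ⟨x, _ | ⟨y, r⟩⟩⟩
    iterate 3
      simp at hlen
      omega
    exact ⟨w, x, y, r, rfl⟩
  have hnd := hr.nodup_iff.1 hc.nodup
  simp only [List.cons_append, List.nil_append, List.nodup_cons, List.mem_cons, not_or] at hnd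
  obtain ⟨⟨-, huw, hux, huy, -⟩, ⟨hvw, hvx, hvy, -⟩, ⟨hwx, hwy, -⟩, ⟨hxy, -⟩, -⟩ := hnd
  have hw : w ∈ l := hr.mem_iff.2 (by simp)
  have hx : x ∈ l := hr.mem_iff.2 (by simp)
  have hy : y ∈ l := hr.mem_iff.2 (by simp)
  have key : ∀ {w x}, w ∈ l → x ∈ l → [u, v, w, x].Nodup →
      ((0 < (pathSets B M s(u, w)).ncard) ∨ 0 < (pathSets B M s(v, x)).ncard) ∧
      ((0 < (pathSets B M s(u, x)).ncard) ∨ 0 < (pathSets B M s(v, w)).ncard) := by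
    intro w x hw hx hn
    have := hc.ncard_pathSets_exchange h hg hM1 hmin hn (by simp [hu, hv, hw, hx])
    omega
  have hdeg : ∀ {i j w x}, i ∈ l → j ∈ l → w ∈ l → x ∈ l → [i, j, w, x].Nodup →
      0 < (pathSets B M s(i, j)).ncard → ¬ (0 < (pathSets B M s(i, w)).ncard ∧
      0 < (pathSets B M s(i, x)).ncard) := by
    rintro i j w x hi hj hw hx hn h1 ⟨h2, h3⟩
    simp only [List.nodup_cons, List.mem_cons, List.not_mem_nil, or_false, not_or] at hn
    rcases hc.eq_or_eq_or_eq_of_pathSets h hg hmin hi hj hw hx hn.1.1 hn.1.2.1 hn.1.2.2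
      ((hpos _).2 h1) ((hpos _).2 h2) ((hpos _).2 h3) with e | e | e
    · exact hn.2.1.1 e
    · exact hn.2.1.2 e
    · exact hn.2.2.1 e
  have hvu := Sym2.eq_swap (a := u) (b := v) ▸ huv'
  have nwx : [u, v, w, x].Nodup := by simp [*]
  have nwy : [u, v, w, y].Nodup := by simp [*]
  have nxy : [u, v, x, y].Nodup := by simp [*]
  have nwx' : [v, u, w, x].Nodup := by simp [*, Ne.symm huv]
  have nwy' : [v, u, w, y].Nodup := by simp [*, Ne.symm huv]
  have nxy' : [v, u, x, y].Nodup := by simp [*, Ne.symm huv]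
  have k1 := key hw hx nwx
  have k2 := key hw hy nwy
  have k3 := key hx hy nxy
  have d1 := hdeg hu hv hw hx nwx huv'
  have d2 := hdeg hu hv hw hy nwy huv'
  have d3 := hdeg hu hv hx hy nxy huv'
  have d4 := hdeg hv hu hw hx nwx' hvu
  have d5 := hdeg hv hu hw hy nwy' hvu
  have d6 := hdeg hv hu hx hy nxy' hvu
  omega

end Exchange

/-- Standing hypotheses: `G` and `H` are 3-regular graphs on the same number `n` of vertices
with the same `(n-2)`-deck, `H` is not isomorphic to `G`, and `g` is the girth of `G`. -/
theorem g1_cycle_propagates_along_g_cycle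
    {V W : Type*} [Fintype V] [Fintype W] [DecidableEq V] [DecidableEq W]
    (G : SimpleGraph V) (H : SimpleGraph W)
    [DecidableRel G.Adj] [DecidableRel H.Adj]
    (hG : G.IsRegularOfDegree 3) (hH : H.IsRegularOfDegree 3)
    (hcard : Fintype.card V = Fintype.card W)
    (hdeck : SameDeck G H (Fintype.card V - 2))
    (hniso : ¬ Nonempty (G ≃g H))
    (g : ℕ) (hgirth : G.egirth = g)
    (w x y z : V) (hpath : ([w, x, y, z] : List V).Nodup)
    (v₀ : V) (C : G.Walk v₀ v₀) (hC : C.IsCycle) (hCl : C.length = g)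
    (h1 : s(w, x) ∈ C.edges) (h2 : s(x, y) ∈ C.edges) (h3 : s(y, z) ∈ C.edges)
    (hwx : ∃ (v : V) (D : G.Walk v v), D.IsCycle ∧ D.length = g + 1 ∧ s(w, x) ∈ D.edges) :
    ∃ (v : V) (B : G.Walk v v), B.IsCycle ∧ B.length = g + 1 ∧ s(y, z) ∈ B.edges := by
  exfalso
  obtain ⟨v, D, hD, hDl, hDe⟩ := hwx
  obtain ⟨l, hl, hll, hle⟩ := exists_list_of_isCycle hC
  obtain ⟨l', hl', hll', -⟩ := exists_list_of_isCycle hD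
  rw [← hle] at h1 h3
  have hg : 4 ≤ g := by
    have hsub : [w, x, y, z] ⊆ l := by
      simp only [List.cons_subset, List.nil_subset, and_true]
      exact ⟨mem_of_mem_cycleEdges h1 (by simp), mem_of_mem_cycleEdges h1 (by simp),
        mem_of_mem_cycleEdges h3 (by simp), mem_of_mem_cycleEdges h3 (by simp)⟩
    have := (List.subperm_of_subset hpath hsub).length_le
    rw [hll, hCl] at this
    exact this
  have hgn : g + 1 ≤ Fintype.card V := by
    rw [← hDl, ← hll']
    exact hl'.length_le_card
  have hsc := switchClosed_of_sameDeck hG hH hcard hdeck hniso (cyclesGe_of_egirth hgirth) hgn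
  have hlG : ∀ e ∈ cycleEdges l, e ∈ G.edgeSet := by
    rw [hle]
    exact fun e he => C.edges_subset_edgeSet he
  have hc := config_deleteEdges (b := true) (P := fun (b : Bool) (K : SimpleGraph V) =>
    if b then Nonempty (K ≃g G) else Nonempty (K ≃g H)) (K := G) ⟨Iso.refl⟩ hl (by omega)
    (hll.trans hCl) hlG
  have hDG : ∀ e ∈ D.edges, e ∈ (withCycle (G.deleteEdges {e | e ∈ cycleEdges l}) l).edgeSet := by
    rw [withCycle_deleteEdges hl (by omega) hlG]
    exact fun e he => D.edges_subset_edgeSet he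
  obtain ⟨m, hm⟩ := hc.exists_hasGap (hD.transfer hDG) (by simpa) (by simpa using hDe) h1
  exact not_hasGap hsc hg m hm
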